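/- arXiv:1801.10539 — 3 statements merged into one kernel-verified Lean document; each statement's English description precedes it below -/
import Mathlib

section
/- Let (M,d,μ) be a metric measure space with 0 < μ(B(x;R)) < ∞ for all x ∈ M, R > 0, and let p : M × M × (0,∞) → [0,∞) be a measurable symmetric kernel satisfying the semigroup property, stochastic completeness, and, for some constant C ∈ [2,∞), the two-sided Li–Yau Gaussian bound C^{-1} e^{-C d(x,y)²/t} (μ(B(x;t^{1/2})) μ(B(y;t^{1/2})))^{-1/2} ≤ p(x,y;t) ≤ C e^{-d(x,y)²/(Ct)} (μ(B(x;t^{1/2})) μ(B(y;t^{1/2})))^{-1/2}, together with volume doubling μ(B(x;2R)) ≤ C μ(B(x;R)). Let Ω ⊆ M be open, define H_Ω(t) = ∫_Ω ∫_Ω p(x,y;t) dμ(y) dμ(x) and μ_Ω(x;R) = μ(B(x;R) ∩ Ω). If ∫_Ω μ_Ω(x;T^{1/2}) / μ(B(x;T^{1/2})) dμ(x) < ∞ for some T > 0, then for all t > 0, K₁ ∫_Ω μ_Ω(x;t^{1/2}) / μ(B(x;t^{1/2})) dμ(x) ≤ H_Ω(t) ≤ K₂ ∫_Ω μ_Ω(x;t^{1/2})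 / μ(B(x;t^{1/2})) dμ(x), where K₁ = C^{-2} e^{-C} and K₂ = 2 C^{15/4} ( C · log( 2 C^{(7/2) + (log C)/(log 2)} ) )^{(3 log C)/(4 log 2)}. -/
open MeasureTheory Metric ENNReal

theorem secondCountableTopology_of_ball_pos {M : Type*} [MetricSpace M] [MeasurableSpace M]
    [BorelSpace M] (μ : Measure M) [SigmaFinite μ]
    (hpos : ∀ x : M, ∀ R : ℝ, 0 < R → 0 < μ (ball x R)) : SecondCountableTopology M := by
  refine Metric.secondCountable_of_almost_dense_set fun ε hε => ?_
  obtain ⟨s, hs⟩ := zorn_subset {s : Set M | s.Pairwise fun x y => ε ≤ dist x y} (by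
    intro c hc hchain
    refine ⟨⋃₀ c, ?_, fun s hs => Set.subset_sUnion_of_mem hs⟩
    exact (Set.pairwise_sUnion hchain.directedOn).2 fun a ha => hc ha)
  refine ⟨s, ?_, fun x => ?_⟩
  · have hdisj : Pairwise (Function.onFun Disjoint fun x : s => ball (x : M) (ε / 2)) := by
      intro x y hxy
      refine ball_disjoint_ball ?_
      have := hs.prop x.2 y.2 (fun h => hxy (Subtype.ext h))
      linarith
    have := Measure.countable_meas_pos_of_disjoint_iUnion (μ := μ)
      (fun x : s => measurableSet_ball) hdisj
    have huniv : {i : s | 0 < μ (ball (i : M) (ε / 2))} = Set.univ :=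
      Set.eq_univ_of_forall fun i => hpos _ _ (half_pos hε)
    rw [huniv, Set.countable_univ_iff] at this
    exact Set.countable_coe_iff.1 this
  · by_contra! h
    have hins : insert x s ⊆ s := hs.le_of_ge (by
      refine Set.pairwise_insert.2 ⟨hs.prop, fun b hb _ => ⟨(h b hb).le, ?_⟩⟩
      rw [dist_comm]
      exact (h b hb).le) (Set.subset_insert x s)
    have := h x (hins (Set.mem_insert x s))
    rw [dist_self] at this
    linarith

theorem sigmaFinite_of_ball_lt_top {M : Type*} [MetricSpace M] [MeasurableSpace M]
    (μ : Measure M) (hfin : ∀ x : M, ∀ R : ℝ, 0 < R → μ (ball x R) < ⊤) : SigmaFinite μ := by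
  rcases isEmpty_or_nonempty M with hM | ⟨⟨o⟩⟩
  · rw [Measure.eq_zero_of_isEmpty μ]; infer_instance
  · refine ⟨⟨⟨fun n : ℕ => ball o (n + 1), fun _ => trivial,
      fun n => hfin o _ (by positivity), ?_⟩⟩⟩
    refine Set.eq_univ_of_forall fun x => Set.mem_iUnion.2 ?_
    obtain ⟨n, hn⟩ := exists_nat_gt (dist x o)
    exact ⟨n, mem_ball.2 (by linarith)⟩

theorem lintegral_mul_lintegral_comm {X Z : Type*} [MeasurableSpace X] [MeasurableSpace Z]
    (ν : Measure X) [SFinite ν] (μ : Measure Z) [SFinite μ] {a : X → ℝ≥0∞} {h : Z → ℝ≥0∞}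
    {E : X → Z → ℝ≥0∞} (ha : Measurable a) (hh : Measurable h)
    (hE : Measurable (Function.uncurry E)) :
    ∫⁻ x, a x * ∫⁻ z, E x z * h z ∂μ ∂ν = ∫⁻ z, (∫⁻ x, a x * E x z ∂ν) * h z ∂μ := by
  have hE1 : ∀ x, Measurable (E x) := fun x => hE.of_uncurry_left
  have hE2 : ∀ z, Measurable fun x => E x z := fun z => hE.of_uncurry_right
  calc ∫⁻ x, a x * ∫⁻ z, E x z * h z ∂μ ∂ν
      = ∫⁻ x, ∫⁻ z, a x * (E x z * h z) ∂μ ∂ν := by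
        refine lintegral_congr fun x => (lintegral_const_mul _ ?_).symm
        exact (hE1 x).mul hh
    _ = ∫⁻ z, ∫⁻ x, a x * (E x z * h z) ∂ν ∂μ := by
        refine lintegral_lintegral_swap (Measurable.aemeasurable ?_)
        exact (ha.comp measurable_fst).mul (hE.mul (hh.comp measurable_snd))
    _ = _ := by
        refine lintegral_congr fun z => ?_
        simp only [← mul_assoc]
        exact lintegral_mul_const _ (ha.mul (hE2 z))

theorem two_mul_mul_le_sq_add_sq (a b : ℝ≥0∞) : 2 * (a * b) ≤ a ^ 2 + b ^ 2 := by
  induction a with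
  | top => simp
  | coe a =>
    induction b with
    | top => simp
    | coe b =>
      norm_cast
      rw [← NNReal.coe_le_coe]
      push_cast
      nlinarith [sq_nonneg ((a : ℝ) - b)]

/-- Schur test for a symmetric kernel, in quadratic-form version. -/
theorem lintegral_lintegral_mul_mul_le {X : Type*} [MeasurableSpace X]
    (ν : Measure X) [SFinite ν] {g : X → ℝ≥0∞} {k : X → X → ℝ≥0∞} (hg : Measurable g)
    (hk : Measurable (Function.uncurry k)) (hsymm : ∀ x y, k x y = k y x) :
    ∫⁻ x, ∫⁻ y, g x * g y * k x y ∂ν ∂ν ≤ ∫⁻ x, ∫⁻ y, g x ^ 2 * k x y ∂ν ∂ν := by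
  have hm1 : Measurable (Function.uncurry fun x y => g x ^ 2 * k x y) :=
    ((hg.comp measurable_fst).pow_const 2).mul hk
  have hm2 : Measurable (Function.uncurry fun x y => g y ^ 2 * k x y) :=
    ((hg.comp measurable_snd).pow_const 2).mul hk
  have hswap : ∫⁻ x, ∫⁻ y, g y ^ 2 * k x y ∂ν ∂ν = ∫⁻ x, ∫⁻ y, g x ^ 2 * k x y ∂ν ∂ν := by
    rw [lintegral_lintegral_swap hm2.aemeasurable]
    simp only [hsymm]
  have h2 : (2 : ℝ≥0∞) * ∫⁻ x, ∫⁻ y, g x * g y * k x y ∂ν ∂ν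
      ≤ 2 * ∫⁻ x, ∫⁻ y, g x ^ 2 * k x y ∂ν ∂ν := by
    calc (2 : ℝ≥0∞) * ∫⁻ x, ∫⁻ y, g x * g y * k x y ∂ν ∂ν
        = ∫⁻ x, ∫⁻ y, 2 * (g x * g y * k x y) ∂ν ∂ν := by
          rw [← lintegral_const_mul' _ _ (by simp)]
          exact lintegral_congr fun x => (lintegral_const_mul' _ _ (by simp)).symm
      _ ≤ ∫⁻ x, ∫⁻ y, (g x ^ 2 * k x y + g y ^ 2 * k x y) ∂ν ∂ν := by
          refine lintegral_mono fun x => lintegral_mono fun y => ?_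
          rw [← add_mul, ← mul_assoc]
          gcongr
          exact two_mul_mul_le_sq_add_sq _ _
      _ = (∫⁻ x, ∫⁻ y, g x ^ 2 * k x y ∂ν ∂ν) + ∫⁻ x, ∫⁻ y, g y ^ 2 * k x y ∂ν ∂ν := by
          rw [← lintegral_add_left hm1.lintegral_prod_right]
          exact lintegral_congr fun x => lintegral_add_left hm1.of_uncurry_left _
      _ = _ := by rw [hswap, two_mul]
  rwa [ENNReal.mul_le_mul_iff_right (by simp) (by simp)] at h2

theorem lintegral_const_mul_mul {X : Type*} [MeasurableSpace X] {μ : Measure X} (c : ℝ≥0∞)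
    {f g : X → ℝ≥0∞} (hf : Measurable f) (hg : Measurable g) :
    ∫⁻ x, c * (f x * g x) ∂μ = c * ∫⁻ x, f x * g x ∂μ :=
  lintegral_const_mul c (hf.mul hg)

/-- The indicator kernel of the relation `dist x y < r`. -/
noncomputable def distLtKernel {M : Type*} [MetricSpace M] (r : ℝ) (x y : M) : ℝ≥0∞ :=
  if dist x y < r then 1 else 0

theorem distLtKernel_comm {M : Type*} [MetricSpace M] (r : ℝ) (x y : M) :
    distLtKernel r x y = distLtKernel r y x := by
  simp only [distLtKernel, dist_comm]

theorem measurable_distLtKernel {M : Type*} [MetricSpace M] [MeasurableSpace M] [BorelSpace M]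
    [SecondCountableTopology M] (r : ℝ) :
    Measurable (Function.uncurry (distLtKernel (M := M) r)) := by
  have : MeasurableSet {q : M × M | dist q.1 q.2 < r} :=
    measurableSet_lt (measurable_fst.dist measurable_snd) measurable_const
  exact Measurable.ite this measurable_const measurable_const

theorem lintegral_distLtKernel {M : Type*} [MetricSpace M] [MeasurableSpace M] [BorelSpace M]
    (ν : Measure M) (r : ℝ) (x : M) :
    ∫⁻ y, distLtKernel r x y ∂ν = ν (ball x r) := by
  rw [← lintegral_indicator_one measurableSet_ball]
  refine lintegral_congr fun y => ?_
  simp [distLtKernel, Set.indicator, dist_comm]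

theorem lintegral_distLtKernel' {M : Type*} [MetricSpace M] [MeasurableSpace M] [BorelSpace M]
    (ν : Measure M) (r : ℝ) (x : M) :
    ∫⁻ y, distLtKernel r y x ∂ν = ν (ball x r) := by
  simp only [← lintegral_distLtKernel ν r x, distLtKernel_comm r x]

theorem measurable_measure_ball {M : Type*} [MetricSpace M] [MeasurableSpace M] [BorelSpace M]
    [SecondCountableTopology M] (ν : Measure M) [SFinite ν] (r : ℝ) :
    Measurable fun x => ν (ball x r) := by
  simp only [← lintegral_distLtKernel]
  exact (measurable_distLtKernel r).lintegral_prod_right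

theorem distLtKernel_mul_mul_le {M : Type*} [MetricSpace M] (r ε : ℝ) (x y z w : M) :
    distLtKernel ε x z * distLtKernel ε y w * distLtKernel r x y ≤
      distLtKernel ε x z * (distLtKernel ε y w * distLtKernel (r + 2 * ε) z w) := by
  simp only [distLtKernel]
  split_ifs with h1 h2 h3 h4 <;> simp
  have h5 := dist_triangle4 z x y w
  rw [dist_comm z x] at h5
  linarith

/-- Replacing a near-diagonal form by the local averages at scale `ε`. -/
theorem lintegral_lintegral_distLtKernel_le_average {M : Type*} [MetricSpace M]
    [MeasurableSpace M] [BorelSpace M] [SecondCountableTopology M]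
    (μ ν : Measure M) [SFinite μ] [SFinite ν] {a : M → ℝ≥0∞} (ha : Measurable a) (r ε : ℝ) :
    ∫⁻ x, ∫⁻ y, (a x * μ (ball x ε)) * (a y * μ (ball y ε)) * distLtKernel r x y ∂ν ∂ν ≤
      ∫⁻ z, ∫⁻ w, (∫⁻ x, a x * distLtKernel ε x z ∂ν) * (∫⁻ x, a x * distLtKernel ε x w ∂ν) *
        distLtKernel (r + 2 * ε) z w ∂μ ∂μ := by
  have hE := measurable_distLtKernel (M := M) ε
  have hD := measurable_distLtKernel (M := M) (r + 2 * ε)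
  have hE1 : ∀ x, Measurable (distLtKernel (M := M) ε x) := fun x => hE.of_uncurry_left
  have hD1 : ∀ x, Measurable (distLtKernel (M := M) (r + 2 * ε) x) :=
    fun x => hD.of_uncurry_left
  have hg : Measurable fun z => ∫⁻ x, a x * distLtKernel ε x z ∂ν :=
    ((ha.comp measurable_fst).mul hE).lintegral_prod_left
  have hgD : Measurable fun z => ∫⁻ w, (∫⁻ x, a x * distLtKernel ε x w ∂ν) *
      distLtKernel (r + 2 * ε) z w ∂μ :=
    ((hg.comp measurable_snd).mul hD).lintegral_prod_right
  have hED : Measurable (Function.uncurry fun z y : M =>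
      ∫⁻ w, distLtKernel ε y w * distLtKernel (r + 2 * ε) z w ∂μ) := by
    refine Measurable.lintegral_prod_right' (f := fun q : (M × M) × M =>
      distLtKernel ε q.1.2 q.2 * distLtKernel (r + 2 * ε) q.1.1 q.2) ?_
    exact (hE.comp ((measurable_snd.comp measurable_fst).prodMk measurable_snd)).mul
      (hD.comp ((measurable_fst.comp measurable_fst).prodMk measurable_snd))
  have hpt : ∀ x y, (a x * μ (ball x ε)) * (a y * μ (ball y ε)) * distLtKernel r x y ≤
      a x * (a y * ∫⁻ z, distLtKernel ε x z *
        ∫⁻ w, distLtKernel ε y w * distLtKernel (r + 2 * ε) z w ∂μ ∂μ) := by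
    intro x y
    calc (a x * μ (ball x ε)) * (a y * μ (ball y ε)) * distLtKernel r x y
        = a x * (a y * ((∫⁻ z, distLtKernel ε x z ∂μ) *
            ((∫⁻ w, distLtKernel ε y w ∂μ) * distLtKernel r x y))) := by
          rw [lintegral_distLtKernel, lintegral_distLtKernel]; ring
      _ = a x * (a y * ∫⁻ z, ∫⁻ w,
            distLtKernel ε x z * distLtKernel ε y w * distLtKernel r x y ∂μ ∂μ) := by
          rw [← lintegral_mul_const _ (hE1 x)]
          congr 2
          refine lintegral_congr fun z => ?_
          rw [← lintegral_mul_const _ (hE1 y), ← lintegral_const_mul _ ((hE1 y).mul_const _)]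
          simp only [mul_assoc]
      _ ≤ _ := by
          gcongr with z
          rw [← lintegral_const_mul_mul _ (hE1 y) (hD1 z)]
          exact lintegral_mono fun w => distLtKernel_mul_mul_le r ε x y z w
  calc _ ≤ ∫⁻ x, ∫⁻ y, a x * (a y * ∫⁻ z, distLtKernel ε x z *
        ∫⁻ w, distLtKernel ε y w * distLtKernel (r + 2 * ε) z w ∂μ ∂μ) ∂ν ∂ν :=
        lintegral_mono fun x => lintegral_mono fun y => hpt x y
    _ = ∫⁻ x, a x * ∫⁻ z, distLtKernel ε x z * ∫⁻ y, a y *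
          ∫⁻ w, distLtKernel ε y w * distLtKernel (r + 2 * ε) z w ∂μ ∂ν ∂μ ∂ν := by
        refine lintegral_congr fun x => ?_
        have hm1 : Measurable fun q : M × M => distLtKernel ε x q.2 *
            ∫⁻ w, distLtKernel ε q.1 w * distLtKernel (r + 2 * ε) q.2 w ∂μ :=
          ((hE1 x).comp measurable_snd).mul (hED.comp measurable_swap)
        rw [lintegral_const_mul_mul _ ha hm1.lintegral_prod_right]
        congr 1
        calc ∫⁻ y, a y * ∫⁻ z, distLtKernel ε x z *
              ∫⁻ w, distLtKernel ε y w * distLtKernel (r + 2 * ε) z w ∂μ ∂μ ∂ν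
            = ∫⁻ y, ∫⁻ z, a y * (distLtKernel ε x z *
              ∫⁻ w, distLtKernel ε y w * distLtKernel (r + 2 * ε) z w ∂μ) ∂μ ∂ν :=
              lintegral_congr fun y =>
                (lintegral_const_mul_mul _ (hE1 x) hED.of_uncurry_right).symm
          _ = ∫⁻ z, ∫⁻ y, a y * (distLtKernel ε x z *
              ∫⁻ w, distLtKernel ε y w * distLtKernel (r + 2 * ε) z w ∂μ) ∂ν ∂μ :=
              lintegral_lintegral_swap ((ha.comp measurable_fst).mul hm1).aemeasurable
          _ = _ := by
              refine lintegral_congr fun z => ?_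
              rw [← lintegral_const_mul_mul _ ha hED.of_uncurry_left]
              exact lintegral_congr fun y => mul_left_comm _ _ _
    _ = ∫⁻ x, a x * ∫⁻ z, distLtKernel ε x z * ∫⁻ w, (∫⁻ x, a x * distLtKernel ε x w ∂ν) *
          distLtKernel (r + 2 * ε) z w ∂μ ∂μ ∂ν := by
        refine lintegral_congr fun x => ?_
        congr 1
        refine lintegral_congr fun z => ?_
        congr 1
        exact lintegral_mul_lintegral_comm ν μ ha (hD1 z) hE
    _ = ∫⁻ z, (∫⁻ x, a x * distLtKernel ε x z ∂ν) * ∫⁻ w,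
          (∫⁻ x, a x * distLtKernel ε x w ∂ν) * distLtKernel (r + 2 * ε) z w ∂μ ∂μ :=
        lintegral_mul_lintegral_comm ν μ ha hgD hE
    _ = _ := by
        refine lintegral_congr fun z => ?_
        rw [← lintegral_const_mul_mul _ hg (hD1 z)]
        simp only [mul_assoc]

theorem lintegral_lintegral_distLtKernel_le {M : Type*} [MetricSpace M]
    [MeasurableSpace M] [BorelSpace M] [SecondCountableTopology M]
    (μ : Measure M) [SigmaFinite μ]
    (hball : ∀ x : M, ∀ R : ℝ, 0 < R → 0 < μ (ball x R) ∧ μ (ball x R) < ⊤)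
    {s r : ℝ} (hs : 0 < s) {A c : ℝ≥0∞}
    (hc : ∀ x, μ (ball x s) ≤ c * μ (ball x (s / 2)))
    (hA : ∀ x, μ (ball x (r + 3 / 2 * s)) ≤ A * μ (ball x s)) (Ω : Set M) :
    ∫⁻ x in Ω, ∫⁻ y in Ω, μ (ball x s) ^ (-(1 : ℝ) / 2) * μ (ball y s) ^ (-(1 : ℝ) / 2) *
        distLtKernel r x y ∂μ ∂μ ≤
      A * c * ∫⁻ x in Ω, μ (ball x s ∩ Ω) / μ (ball x s) ∂μ := by
  set ν := μ.restrict Ω with hν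
  set V : M → ℝ≥0∞ := fun x => μ (ball x s) with hV
  set W : M → ℝ≥0∞ := fun x => μ (ball x (s / 2)) with hW
  have hV0 : ∀ x, V x ≠ 0 := fun x => (hball x s hs).1.ne'
  have hVt : ∀ x, V x ≠ ⊤ := fun x => (hball x s hs).2.ne
  have hW0 : ∀ x, W x ≠ 0 := fun x => (hball x _ (half_pos hs)).1.ne'
  have hWt : ∀ x, W x ≠ ⊤ := fun x => (hball x _ (half_pos hs)).2.ne
  have hVm : Measurable V := measurable_measure_ball μ s
  have hWm : Measurable W := measurable_measure_ball μ (s / 2)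
  set a : M → ℝ≥0∞ := fun x => V x ^ (-(1 : ℝ) / 2) * (W x)⁻¹ with ha
  have ham : Measurable a := (hVm.pow_const _).mul hWm.inv
  have haW : ∀ x, a x * W x = V x ^ (-(1 : ℝ) / 2) := fun x => by
    rw [ha, mul_assoc, ENNReal.inv_mul_cancel (hW0 x) (hWt x), mul_one]
  have hasq : ∀ x, a x ^ 2 * (A * V x * W x) ≤ A * c * (V x)⁻¹ := by
    intro x
    have h1 : (V x ^ (-(1 : ℝ) / 2)) ^ 2 = (V x)⁻¹ := by
      rw [← ENNReal.rpow_natCast, ← ENNReal.rpow_mul, ← ENNReal.rpow_neg_one]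
      norm_num
    have h2 : (W x)⁻¹ ≤ c * (V x)⁻¹ := by
      rw [← div_eq_mul_inv, ENNReal.le_div_iff_mul_le (Or.inl (hV0 x)) (Or.inl (hVt x)),
        mul_comm, ← div_eq_mul_inv]
      exact ENNReal.div_le_of_le_mul (hc x)
    calc a x ^ 2 * (A * V x * W x)
        = A * (V x * (V x)⁻¹) * ((W x)⁻¹ * ((W x)⁻¹ * W x)) := by
          rw [ha]; simp only [mul_pow, h1]; ring
      _ = A * (W x)⁻¹ := by
          rw [ENNReal.mul_inv_cancel (hV0 x) (hVt x), ENNReal.inv_mul_cancel (hW0 x) (hWt x),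
            mul_one, mul_one]
      _ ≤ A * (c * (V x)⁻¹) := by gcongr
      _ = _ := (mul_assoc _ _ _).symm
  set ε := s / 2 with hε
  have hE := measurable_distLtKernel (M := M) ε
  have hE1 : ∀ x, Measurable (distLtKernel (M := M) ε x) := fun x => hE.of_uncurry_left
  have hD := measurable_distLtKernel (M := M) (r + 2 * ε)
  set g : M → ℝ≥0∞ := fun z => ∫⁻ x, a x * distLtKernel ε x z ∂ν with hg
  have hgm : Measurable g := ((ham.comp measurable_fst).mul hE).lintegral_prod_left
  set U : M → ℝ≥0∞ := fun z => μ (ball z (r + 2 * ε)) with hU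
  have hUm : Measurable U := measurable_measure_ball μ _
  set k : M → M → ℝ≥0∞ := fun x y =>
    ∫⁻ z, distLtKernel ε x z * (distLtKernel ε y z * U z) ∂μ with hk
  have hkm : Measurable (Function.uncurry k) := by
    refine Measurable.lintegral_prod_right' (f := fun q : (M × M) × M =>
      distLtKernel ε q.1.1 q.2 * (distLtKernel ε q.1.2 q.2 * U q.2)) ?_
    exact (hE.comp ((measurable_fst.comp measurable_fst).prodMk measurable_snd)).mul
      ((hE.comp ((measurable_snd.comp measurable_fst).prodMk measurable_snd)).mul
        (hUm.comp measurable_snd))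
  have hks : ∀ x y, k x y = k y x := fun x y =>
    lintegral_congr fun z => mul_left_comm _ _ _
  have hkle : ∀ x y, k x y ≤ A * V x * W x * distLtKernel s x y := by
    intro x y
    have hpt : ∀ z, distLtKernel ε x z * (distLtKernel ε y z * U z) ≤
        A * V x * distLtKernel s x y * distLtKernel ε x z := by
      intro z
      by_cases h1 : dist x z < ε
      · by_cases h2 : dist y z < ε
        · have h3 : dist x y < s := by
            have := dist_triangle_right x y z
            rw [hε] at h1 h2
            linarith
          have h4 : U z ≤ A * V x := by
            refine (measure_mono (ball_subset_ball' ?_)).trans (hA x)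
            rw [dist_comm, hε]
            rw [hε] at h1
            linarith
          simpa [distLtKernel, h1, h2, h3] using h4
        · simp [distLtKernel, h2]
      · simp [distLtKernel, h1]
    calc k x y ≤ ∫⁻ z, A * V x * distLtKernel s x y * distLtKernel ε x z ∂μ :=
          lintegral_mono hpt
      _ = A * V x * distLtKernel s x y * W x := by
          rw [lintegral_const_mul _ (hE1 x), lintegral_distLtKernel]
      _ = _ := by ring
  calc _ = ∫⁻ x, ∫⁻ y, (a x * μ (ball x ε)) * (a y * μ (ball y ε)) *
        distLtKernel r x y ∂ν ∂ν := by
        refine lintegral_congr fun x => lintegral_congr fun y => ?_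
        rw [← haW, ← haW]
    _ ≤ ∫⁻ z, ∫⁻ w, g z * g w * distLtKernel (r + 2 * ε) z w ∂μ ∂μ :=
        lintegral_lintegral_distLtKernel_le_average μ ν ham r ε
    _ ≤ ∫⁻ z, ∫⁻ w, g z ^ 2 * distLtKernel (r + 2 * ε) z w ∂μ ∂μ :=
        lintegral_lintegral_mul_mul_le μ hgm hD (distLtKernel_comm _)
    _ = ∫⁻ z, g z * (g z * U z) ∂μ := by
        refine lintegral_congr fun z => ?_
        rw [lintegral_const_mul _ hD.of_uncurry_left, lintegral_distLtKernel, sq, mul_assoc]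
    _ = ∫⁻ x, a x * ∫⁻ z, distLtKernel ε x z * (g z * U z) ∂μ ∂ν :=
        (lintegral_mul_lintegral_comm ν μ ham (hgm.mul hUm) hE).symm
    _ = ∫⁻ x, a x * ∫⁻ y, a y * k x y ∂ν ∂ν := by
        refine lintegral_congr fun x => ?_
        congr 1
        calc ∫⁻ z, distLtKernel ε x z * (g z * U z) ∂μ
            = ∫⁻ z, g z * (distLtKernel ε x z * U z) ∂μ :=
              lintegral_congr fun z => mul_left_comm _ _ _
          _ = ∫⁻ y, a y * ∫⁻ z, distLtKernel ε y z * (distLtKernel ε x z * U z) ∂μ ∂ν :=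
              (lintegral_mul_lintegral_comm ν μ ham ((hE1 x).mul hUm) hE).symm
          _ = ∫⁻ y, a y * k x y ∂ν := lintegral_congr fun y => by rw [hks x y]
    _ = ∫⁻ x, ∫⁻ y, a x * a y * k x y ∂ν ∂ν := by
        refine lintegral_congr fun x => ?_
        rw [← lintegral_const_mul_mul _ ham hkm.of_uncurry_left]
        simp only [mul_assoc]
    _ ≤ ∫⁻ x, ∫⁻ y, a x ^ 2 * k x y ∂ν ∂ν :=
        lintegral_lintegral_mul_mul_le ν ham hkm hks
    _ ≤ ∫⁻ x, ∫⁻ y, A * c * (V x)⁻¹ * distLtKernel s x y ∂ν ∂ν := by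
        refine lintegral_mono fun x => lintegral_mono fun y => ?_
        calc a x ^ 2 * k x y ≤ a x ^ 2 * (A * V x * W x * distLtKernel s x y) := by
              gcongr; exact hkle x y
          _ = a x ^ 2 * (A * V x * W x) * distLtKernel s x y := (mul_assoc _ _ _).symm
          _ ≤ _ := mul_le_mul_left (hasq x) _
    _ = ∫⁻ x, A * c * (μ (ball x s ∩ Ω) / V x) ∂ν := by
        refine lintegral_congr fun x => ?_
        rw [lintegral_const_mul _ (measurable_distLtKernel s).of_uncurry_left,
          lintegral_distLtKernel, hν, Measure.restrict_apply measurableSet_ball,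
          div_eq_mul_inv]
        ring
    _ = _ := by
        refine lintegral_const_mul _ ?_
        refine Measurable.div ?_ hVm
        have h := measurable_measure_ball ν s
        simpa only [hν, Measure.restrict_apply measurableSet_ball] using h

theorem measure_ball_mul_le_rpow {M : Type*} [MetricSpace M] [MeasurableSpace M]
    (μ : Measure M) {C : ℝ} (hC : 1 ≤ C)
    (hdbl : ∀ x : M, ∀ R : ℝ, 0 < R →
      μ (ball x (2 * R)) ≤ ENNReal.ofReal C * μ (ball x R))
    (x : M) {a s : ℝ} (ha : 1 ≤ a) (hs : 0 < s) :
    μ (ball x (a * s)) ≤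
      ENNReal.ofReal (C * a ^ (Real.log C / Real.log 2)) * μ (ball x s) := by
  have hiter : ∀ k : ℕ, μ (ball x (2 ^ k * s)) ≤ ENNReal.ofReal (C ^ k) * μ (ball x s) := by
    intro k
    induction k with
    | zero => simp
    | succ k ih =>
      calc μ (ball x (2 ^ (k + 1) * s)) = μ (ball x (2 * (2 ^ k * s))) := by
            rw [pow_succ]; ring_nf
        _ ≤ ENNReal.ofReal C * (ENNReal.ofReal (C ^ k) * μ (ball x s)) :=
            (hdbl x _ (by positivity)).trans (by gcongr)
        _ = _ := by
            rw [← mul_assoc, ← ENNReal.ofReal_mul (by positivity), pow_succ']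
  have ha0 : 0 < a := by linarith
  have hC0 : 0 < C := by linarith
  have hlog2 : 0 < Real.log 2 := Real.log_pos (by norm_num)
  set k := ⌈Real.log a / Real.log 2⌉₊ with hk
  have hka : a ≤ 2 ^ k := by
    have h := Nat.le_ceil (Real.log a / Real.log 2)
    rw [div_le_iff₀ hlog2] at h
    rw [← Real.log_le_log_iff ha0 (by positivity), Real.log_pow]
    exact h
  have hCk : C ^ k ≤ C * a ^ (Real.log C / Real.log 2) := by
    have h := (Nat.ceil_lt_add_one (div_nonneg (Real.log_nonneg ha) hlog2.le)).le
    calc C ^ k = C ^ (k : ℝ) := (Real.rpow_natCast C k).symm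
      _ ≤ C ^ (Real.log a / Real.log 2 + 1) := Real.rpow_le_rpow_of_exponent_le hC h
      _ = C * a ^ (Real.log C / Real.log 2) := by
          rw [Real.rpow_add hC0, Real.rpow_one, Real.rpow_def_of_pos hC0,
            Real.rpow_def_of_pos ha0, mul_comm]
          ring_nf
  calc μ (ball x (a * s)) ≤ μ (ball x (2 ^ k * s)) :=
        measure_mono (ball_subset_ball (by gcongr))
    _ ≤ _ := (hiter k).trans (by gcongr)

theorem exp_neg_half_le : Real.exp (-(1 / 2)) ≤ 2 / 3 := by
  have h : (3 / 2 : ℝ) ≤ Real.exp (1 / 2) := by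
    have := Real.add_one_le_exp (1 / 2 : ℝ)
    linarith
  rw [Real.exp_neg, inv_le_comm₀ (Real.exp_pos _) (by norm_num)]
  linarith

theorem exp_neg_sq_mul_rpow_le {C : ℝ} (hC : 2 ≤ C) (m : ℕ) :
    Real.exp (-(m : ℝ) ^ 2) * (√C * (m + 1) + 3 / 2) ^ (Real.log C / Real.log 2) ≤
      (2 / 3) ^ m * (C * Real.log (2 * C ^ ((7 : ℝ) / 2 + Real.log C / Real.log 2))) ^
        (3 * Real.log C / (4 * Real.log 2)) := by
  have hlog2 : 0 < Real.log 2 := Real.log_pos (by norm_num)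
  have hC0 : 0 < C := by linarith
  set N := Real.log C / Real.log 2 with hN
  have hlogC : Real.log C = N * Real.log 2 := by rw [hN]; field_simp
  have hN1 : 1 ≤ N := by
    rw [hN, one_le_div hlog2]
    exact Real.log_le_log (by norm_num) hC
  set L := C * Real.log (2 * C ^ ((7 : ℝ) / 2 + N)) with hL
  have hLlow : 3.79 * (C * N) ≤ L := by
    have h1 : Real.log (2 * C ^ ((7 : ℝ) / 2 + N)) = Real.log 2 * (1 + (7 / 2 + N) * N) := by
      rw [Real.log_mul (by norm_num) (by positivity), Real.log_rpow hC0, hlogC]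
      ring
    have h2 : 3.79 * N ≤ Real.log 2 * (1 + (7 / 2 + N) * N) := by
      have h3 : 5.5 * N ≤ 1 + (7 / 2 + N) * N := by nlinarith
      nlinarith [Real.log_two_gt_d9]
    rw [hL, h1]
    nlinarith
  have hCN : 2 ≤ C * N := by nlinarith
  have hL0 : 0 < L := by nlinarith
  set e := Real.exp (-(m : ℝ) ^ 2 / (2 * N)) with he
  have he0 : 0 < e := Real.exp_pos _
  have hesq : e ^ 2 = Real.exp (-((m : ℝ) ^ 2 / N)) := by
    rw [he, ← Real.exp_nat_mul]
    congr 1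
    push_cast
    field_simp
  have he1 : e ^ 2 ≤ 1 := by
    rw [hesq]
    exact Real.exp_le_one_iff.2 (neg_nonpos.2 (by positivity))
  have hme : (m : ℝ) ^ 2 * e ^ 2 ≤ N / 2 := by
    have hu : (0 : ℝ) ≤ (m : ℝ) ^ 2 / N := by positivity
    have h1 : 2 * ((m : ℝ) ^ 2 / N) ≤ Real.exp ((m : ℝ) ^ 2 / N) := by
      have := Real.quadratic_le_exp_of_nonneg hu
      nlinarith [sq_nonneg ((m : ℝ) ^ 2 / N - 1)]
    rw [hesq, Real.exp_neg, ← div_eq_mul_inv, div_le_iff₀ (Real.exp_pos _)]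
    calc (m : ℝ) ^ 2 = N / 2 * (2 * ((m : ℝ) ^ 2 / N)) := by field_simp
      _ ≤ _ := by gcongr
  set b := √C * (m + 1) + 3 / 2 with hb
  have hb0 : 0 < b := by positivity
  have hsq : √C ^ 2 = C := Real.sq_sqrt hC0.le
  have hble : b ≤ √C * (m + 2.0625) := by
    have : 1.4142 ≤ √C := Real.le_sqrt_of_sq_le (by norm_num; linarith)
    rw [hb]
    nlinarith
  have hX2 : (e * b) ^ 2 ≤ 9.52 * (C * N) := by
    have h1 : b ^ 2 ≤ C * (2 * (m : ℝ) ^ 2 + 8.52) := by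
      calc b ^ 2 ≤ (√C * (m + 2.0625)) ^ 2 := by gcongr
        _ = C * (m + 2.0625) ^ 2 := by rw [mul_pow, hsq]
        _ ≤ _ := by
          gcongr
          nlinarith [sq_nonneg ((m : ℝ) - 2.0625)]
    calc (e * b) ^ 2 = e ^ 2 * b ^ 2 := mul_pow _ _ _
      _ ≤ e ^ 2 * (C * (2 * (m : ℝ) ^ 2 + 8.52)) := by gcongr
      _ = C * (2 * ((m : ℝ) ^ 2 * e ^ 2) + 8.52 * e ^ 2) := by ring
      _ ≤ C * (2 * (N / 2) + 8.52 * 1) := by gcongr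
      _ ≤ 9.52 * (C * N) := by nlinarith
  have hX : e * b ≤ L ^ ((3 : ℝ) / 4) := by
    have h4 : (e * b) ^ 4 ≤ L ^ 3 := by
      calc (e * b) ^ 4 = ((e * b) ^ 2) ^ 2 := by ring
        _ ≤ (9.52 * (C * N)) ^ 2 := by gcongr
        _ ≤ (3.79 * (C * N)) ^ 3 := by nlinarith [sq_nonneg (C * N)]
        _ ≤ L ^ 3 := by gcongr
    refine le_of_pow_le_pow_left₀ (n := 4) (by norm_num) (by positivity) (h4.trans_eq ?_)
    rw [← Real.rpow_natCast, ← Real.rpow_natCast, ← Real.rpow_mul hL0.le]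
    norm_num
  have hsplit : Real.exp (-(m : ℝ) ^ 2) = Real.exp (-((m : ℝ) ^ 2 / 2)) * e ^ N := by
    rw [he, ← Real.exp_mul, ← Real.exp_add]
    congr 1
    field_simp
    ring
  have hgeom : Real.exp (-((m : ℝ) ^ 2 / 2)) ≤ (2 / 3) ^ m := by
    calc Real.exp (-((m : ℝ) ^ 2 / 2)) ≤ Real.exp (m * -(1 / 2)) := by
          refine Real.exp_le_exp.2 ?_
          have : (m : ℝ) ≤ (m : ℝ) ^ 2 := by exact_mod_cast Nat.le_self_pow (by norm_num) m
          linarith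
      _ = Real.exp (-(1 / 2)) ^ m := Real.exp_nat_mul _ _
      _ ≤ _ := by gcongr; exact exp_neg_half_le
  calc Real.exp (-(m : ℝ) ^ 2) * b ^ N = Real.exp (-((m : ℝ) ^ 2 / 2)) * (e * b) ^ N := by
        rw [hsplit, Real.mul_rpow he0.le hb0.le, mul_assoc]
    _ ≤ (2 / 3) ^ m * (L ^ ((3 : ℝ) / 4)) ^ N := by gcongr
    _ = _ := by
        rw [← Real.rpow_mul hL0.le, hN]
        congr 2
        field_simp

theorem three_le_two_mul_rpow {C : ℝ} (hC : 2 ≤ C) : 3 ≤ 2 * C ^ ((3 : ℝ) / 4) := by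
  have h : (3 / 2 : ℝ) ≤ C ^ ((3 : ℝ) / 4) := by
    refine le_of_pow_le_pow_left₀ (n := 4) (by norm_num) (by positivity) ?_
    rw [← Real.rpow_natCast (C ^ ((3 : ℝ) / 4)), ← Real.rpow_mul (by linarith)]
    calc (3 / 2 : ℝ) ^ 4 ≤ 2 ^ 3 := by norm_num
      _ ≤ C ^ 3 := by gcongr
      _ = _ := by rw [← Real.rpow_natCast]; norm_num
  linarith

theorem ofReal_mul_lintegral_le_lintegral_heatKernel {M : Type*} [MetricSpace M]
    [MeasurableSpace M] [BorelSpace M] [SecondCountableTopology M]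
    (μ : Measure M)
    {C : ℝ} (hC : 2 ≤ C)
    (hdbl : ∀ x : M, ∀ R : ℝ, 0 < R →
      μ (ball x (2 * R)) ≤ ENNReal.ofReal C * μ (ball x R))
    {t : ℝ} (ht : 0 < t) {q : M → M → ℝ≥0∞}
    (hq : ∀ x y : M, ENNReal.ofReal (C⁻¹ * Real.exp (-(C * dist x y ^ 2) / t)) *
        (μ (ball x (Real.sqrt t)) * μ (ball y (Real.sqrt t))) ^ (-(1 : ℝ) / 2) ≤ q x y)
    (Ω : Set M) :
    ENNReal.ofReal (C ^ (-2 : ℝ) * Real.exp (-C)) *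
        (∫⁻ x in Ω, μ (ball x (Real.sqrt t) ∩ Ω) / μ (ball x (Real.sqrt t)) ∂μ) ≤
      ∫⁻ x in Ω, ∫⁻ y in Ω, q x y ∂μ ∂μ := by
  have hC0 : 0 < C := by linarith
  have hs : 0 < √t := Real.sqrt_pos.2 ht
  have hCof0 : ENNReal.ofReal C ≠ 0 := (ENNReal.ofReal_pos.2 hC0).ne'
  have hconst : ENNReal.ofReal (C ^ (-2 : ℝ) * Real.exp (-C)) =
      ENNReal.ofReal (C⁻¹ * Real.exp (-C)) * (ENNReal.ofReal C)⁻¹ := by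
    rw [← ENNReal.ofReal_inv_of_pos hC0, ← ENNReal.ofReal_mul (by positivity),
      show (-2 : ℝ) = -((2 : ℕ) : ℝ) by norm_num, Real.rpow_neg hC0.le, Real.rpow_natCast]
    congr 1
    field_simp
  have hpt : ∀ x y : M, y ∈ ball x (√t) →
      ENNReal.ofReal (C ^ (-2 : ℝ) * Real.exp (-C)) * (μ (ball x (√t)))⁻¹ ≤ q x y := by
    intro x y hy
    refine le_trans ?_ (hq x y)
    rw [mem_ball, dist_comm] at hy
    rw [hconst, mul_assoc]
    gcongr ENNReal.ofReal ?_ * ?_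
    · have hd : dist x y ^ 2 ≤ t := by
        rw [← Real.sq_sqrt ht.le]
        gcongr
      gcongr
      rw [neg_div, neg_le_neg_iff, div_le_iff₀ ht]
      gcongr
    · have hy2 : μ (ball y (√t)) ≤ ENNReal.ofReal C * μ (ball x (√t)) := by
        refine (measure_mono (ball_subset_ball' ?_)).trans (hdbl x _ hs)
        rw [dist_comm]
        linarith
      have hx1 : μ (ball x (√t)) ≤ ENNReal.ofReal C * μ (ball x (√t)) := by
        refine le_mul_of_one_le_left' ?_
        rw [ENNReal.one_le_ofReal]
        linarith
      have h := mul_le_mul' hx1 hy2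
      calc (ENNReal.ofReal C)⁻¹ * (μ (ball x (√t)))⁻¹
          = (ENNReal.ofReal C * μ (ball x (√t)))⁻¹ :=
            (ENNReal.mul_inv (Or.inl hCof0) (Or.inl ENNReal.ofReal_ne_top)).symm
        _ = ((ENNReal.ofReal C * μ (ball x (√t))) ^ 2) ^ (-(1 : ℝ) / 2) := by
            rw [← ENNReal.rpow_natCast, ← ENNReal.rpow_mul, ← ENNReal.rpow_neg_one]
            norm_num
        _ ≤ _ := by
            rw [sq, neg_div, ENNReal.rpow_neg, ENNReal.rpow_neg]
            exact ENNReal.inv_le_inv.2 (ENNReal.rpow_le_rpow h (by norm_num))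
  rw [← lintegral_const_mul' _ _ ENNReal.ofReal_ne_top]
  refine lintegral_mono fun x => ?_
  calc _ = ∫⁻ _ in ball x (√t), ENNReal.ofReal (C ^ (-2 : ℝ) * Real.exp (-C)) *
        (μ (ball x (√t)))⁻¹ ∂(μ.restrict Ω) := by
        rw [setLIntegral_const, Measure.restrict_apply measurableSet_ball, div_eq_mul_inv]
        ring
    _ ≤ ∫⁻ y in ball x (√t), q x y ∂(μ.restrict Ω) :=
        setLIntegral_mono' measurableSet_ball fun y hy => hpt x y hy
    _ ≤ _ := setLIntegral_le_lintegral _ _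

theorem exp_neg_mul_le_tsum_distLtKernel {M : Type*} [MetricSpace M] {C t : ℝ} (hC : 0 < C)
    (ht : 0 < t) (x y : M) :
    ENNReal.ofReal (C * Real.exp (-(dist x y ^ 2) / (C * t))) ≤
      ∑' m : ℕ, ENNReal.ofReal (C * Real.exp (-(m : ℝ) ^ 2)) *
        distLtKernel (√C * (m + 1) * √t) x y := by
  have hpos : 0 < √C * √t := mul_pos (Real.sqrt_pos.2 hC) (Real.sqrt_pos.2 ht)
  refine le_trans ?_ (ENNReal.le_tsum ⌊dist x y / (√C * √t)⌋₊)
  set m := ⌊dist x y / (√C * √t)⌋₊ with hm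
  have h1 : (m : ℝ) ≤ dist x y / (√C * √t) := Nat.floor_le (by positivity)
  have h2 : dist x y < √C * (m + 1) * √t := by
    have := Nat.lt_floor_add_one (dist x y / (√C * √t))
    rw [div_lt_iff₀ hpos] at this
    linarith
  have h3 : (m : ℝ) ^ 2 ≤ dist x y ^ 2 / (C * t) := by
    calc (m : ℝ) ^ 2 ≤ (dist x y / (√C * √t)) ^ 2 := by gcongr
      _ = _ := by rw [div_pow, mul_pow, Real.sq_sqrt hC.le, Real.sq_sqrt ht.le]
  rw [distLtKernel, if_pos h2, mul_one]
  gcongr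
  rw [neg_div]
  gcongr

theorem lintegral_heatKernel_le {M : Type*} [MetricSpace M]
    [MeasurableSpace M] [BorelSpace M] [SecondCountableTopology M]
    (μ : Measure M) [SigmaFinite μ]
    (hball : ∀ x : M, ∀ R : ℝ, 0 < R → 0 < μ (ball x R) ∧ μ (ball x R) < ⊤)
    {C : ℝ} (hC : 2 ≤ C)
    (hdbl : ∀ x : M, ∀ R : ℝ, 0 < R →
      μ (ball x (2 * R)) ≤ ENNReal.ofReal C * μ (ball x R))
    {t : ℝ} (ht : 0 < t) {q : M → M → ℝ≥0∞}
    (hq : ∀ x y : M, q x y ≤ ENNReal.ofReal (C * Real.exp (-(dist x y ^ 2) / (C * t))) *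
        (μ (ball x (Real.sqrt t)) * μ (ball y (Real.sqrt t))) ^ (-(1 : ℝ) / 2))
    (Ω : Set M) :
    ∫⁻ x in Ω, ∫⁻ y in Ω, q x y ∂μ ∂μ ≤
      ENNReal.ofReal (2 * C ^ ((15 : ℝ) / 4) *
            (C * Real.log (2 * C ^ ((7 : ℝ) / 2 + Real.log C / Real.log 2))) ^
              (3 * Real.log C / (4 * Real.log 2))) *
        (∫⁻ x in Ω, μ (ball x (Real.sqrt t) ∩ Ω) / μ (ball x (Real.sqrt t)) ∂μ) := by
  have hC0 : 0 < C := by linarith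
  have hs : 0 < √t := Real.sqrt_pos.2 ht
  set Φ := ∫⁻ x in Ω, μ (ball x (√t) ∩ Ω) / μ (ball x (√t)) ∂μ with hΦ
  set N := Real.log C / Real.log 2 with hN
  set P := (C * Real.log (2 * C ^ ((7 : ℝ) / 2 + N))) ^
    (3 * Real.log C / (4 * Real.log 2)) with hP
  have hP0 : 0 ≤ P := by
    refine Real.rpow_nonneg (mul_nonneg hC0.le (Real.log_nonneg ?_)) _
    have hN0 : 0 ≤ N := div_nonneg (Real.log_nonneg (by linarith)) (Real.log_nonneg (by norm_num))
    have := Real.one_le_rpow (show 1 ≤ C by linarith) (show 0 ≤ (7 : ℝ) / 2 + N by positivity)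
    linarith
  set v : M → ℝ≥0∞ := fun x => μ (ball x (√t)) ^ (-(1 : ℝ) / 2) with hv
  have hvm : Measurable v := (measurable_measure_ball μ _).pow_const _
  have hnear : ∀ m : ℕ, ∫⁻ x in Ω, ∫⁻ y in Ω, v x * v y *
      distLtKernel (√C * (m + 1) * √t) x y ∂μ ∂μ ≤
      ENNReal.ofReal (C * (√C * (m + 1) + 3 / 2) ^ N) * ENNReal.ofReal C * Φ := by
    intro m
    refine lintegral_lintegral_distLtKernel_le μ hball hs (fun x => ?_) (fun x => ?_) Ω
    · simpa [mul_div_cancel₀] using hdbl x (√t / 2) (half_pos hs)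
    · rw [← add_mul]
      refine measure_ball_mul_le_rpow μ (by linarith) hdbl x ?_ hs
      have : 0 ≤ √C * (m + 1) := by positivity
      linarith
  have hterm : ∀ m : ℕ, ENNReal.ofReal (C * Real.exp (-(m : ℝ) ^ 2)) *
      (ENNReal.ofReal (C * (√C * (m + 1) + 3 / 2) ^ N) * ENNReal.ofReal C * Φ) ≤
      ENNReal.ofReal (C ^ 3 * P) * Φ * ENNReal.ofReal (2 / 3) ^ m := by
    intro m
    rw [← ENNReal.ofReal_pow (by norm_num), mul_right_comm (ENNReal.ofReal (C ^ 3 * P)) Φ,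
      ← mul_assoc, ← ENNReal.ofReal_mul (by positivity), ← ENNReal.ofReal_mul (by positivity),
      ← ENNReal.ofReal_mul (by positivity)]
    refine mul_le_mul_left (ENNReal.ofReal_le_ofReal ?_) Φ
    calc C * Real.exp (-(m : ℝ) ^ 2) * (C * (√C * (m + 1) + 3 / 2) ^ N * C)
        = C ^ 3 * (Real.exp (-(m : ℝ) ^ 2) * (√C * (m + 1) + 3 / 2) ^ N) := by ring
      _ ≤ C ^ 3 * ((2 / 3) ^ m * P) := by
          exact mul_le_mul_of_nonneg_left (exp_neg_sq_mul_rpow_le hC m) (by positivity)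
      _ = _ := by ring
  have hgeom : ∑' m : ℕ, ENNReal.ofReal (2 / 3) ^ m = ENNReal.ofReal 3 := by
    rw [ENNReal.tsum_geometric, ← ENNReal.ofReal_one, ← ENNReal.ofReal_sub _ (by norm_num),
      ← ENNReal.ofReal_inv_of_pos (by norm_num)]
    norm_num
  have hFm : ∀ m : ℕ, Measurable fun z : M × M => ENNReal.ofReal (C * Real.exp (-(m : ℝ) ^ 2)) *
      (v z.1 * v z.2 * distLtKernel (√C * (m + 1) * √t) z.1 z.2) := fun m =>
    (((hvm.comp measurable_fst).mul (hvm.comp measurable_snd)).mul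
      (measurable_distLtKernel _)).const_mul _
  calc ∫⁻ x in Ω, ∫⁻ y in Ω, q x y ∂μ ∂μ
      ≤ ∫⁻ x in Ω, ∫⁻ y in Ω, ∑' m : ℕ, ENNReal.ofReal (C * Real.exp (-(m : ℝ) ^ 2)) *
          (v x * v y * distLtKernel (√C * (m + 1) * √t) x y) ∂μ ∂μ := by
        refine lintegral_mono fun x => lintegral_mono fun y => (hq x y).trans ?_
        rw [ENNReal.mul_rpow_of_ne_top (hball x _ hs).2.ne (hball y _ hs).2.ne]
        calc _ ≤ (∑' m : ℕ, ENNReal.ofReal (C * Real.exp (-(m : ℝ) ^ 2)) *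
              distLtKernel (√C * (m + 1) * √t) x y) * (v x * v y) :=
              mul_le_mul_left (exp_neg_mul_le_tsum_distLtKernel hC0 ht x y) _
          _ = _ := by
              rw [← ENNReal.tsum_mul_right]
              exact tsum_congr fun m => by ring
    _ = ∑' m : ℕ, ENNReal.ofReal (C * Real.exp (-(m : ℝ) ^ 2)) *
          ∫⁻ x in Ω, ∫⁻ y in Ω, v x * v y * distLtKernel (√C * (m + 1) * √t) x y ∂μ ∂μ := by
        refine (lintegral_congr fun x => lintegral_tsum fun m =>
          ((hFm m).comp measurable_prodMk_left).aemeasurable).trans ?_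
        refine (lintegral_tsum fun m => (hFm m).lintegral_prod_right'.aemeasurable).trans ?_
        refine tsum_congr fun m => ?_
        rw [← lintegral_const_mul' _ _ ENNReal.ofReal_ne_top]
        exact lintegral_congr fun x => lintegral_const_mul' _ _ ENNReal.ofReal_ne_top
    _ ≤ ∑' m : ℕ, ENNReal.ofReal (C ^ 3 * P) * Φ * ENNReal.ofReal (2 / 3) ^ m :=
        ENNReal.tsum_le_tsum fun m => (mul_le_mul_right (hnear m) _).trans (hterm m)
    _ = ENNReal.ofReal (C ^ 3 * P * 3) * Φ := by
        rw [ENNReal.tsum_mul_left, hgeom, ENNReal.ofReal_mul (p := C ^ 3 * P) (by positivity)]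
        ring
    _ ≤ _ := by
        refine mul_le_mul_left (ENNReal.ofReal_le_ofReal ?_) Φ
        calc C ^ 3 * P * 3 ≤ C ^ 3 * P * (2 * C ^ ((3 : ℝ) / 4)) := by
              gcongr
              exact three_le_two_mul_rpow hC
          _ = 2 * (C ^ 3 * C ^ ((3 : ℝ) / 4)) * P := by ring
          _ = _ := by
              rw [← Real.rpow_natCast C 3, ← Real.rpow_add hC0]
              norm_num

/-- Theorem 1(ii): under the Li–Yau bound and volume doubling, if
`∫_Ω μ(B(x;√T) ∩ Ω)/μ(B(x;√T)) dμ(x) < ∞` for some `T > 0`, then for all `t > 0` the heat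
content `H_Ω(t)` is bounded above and below by constant multiples of
`∫_Ω μ(B(x;√t) ∩ Ω)/μ(B(x;√t)) dμ(x)`, with `K₁ = C⁻² e^{-C}` and
`K₂ = 2 C^{15/4} (C log(2 C^{7/2 + log C/log 2}))^{3 log C/(4 log 2)}`. -/
theorem heat_content_two_sided_bounds
    {M : Type*} [MetricSpace M] [MeasurableSpace M] [BorelSpace M]
    (μ : Measure M)
    (hball : ∀ x : M, ∀ R : ℝ, 0 < R → 0 < μ (ball x R) ∧ μ (ball x R) < ⊤)
    (p : M → M → ℝ → ℝ≥0∞)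
    (hp_meas : Measurable fun q : M × M × ℝ => p q.1 q.2.1 q.2.2)
    (hp_symm : ∀ x y : M, ∀ t : ℝ, 0 < t → p x y t = p y x t)
    (hp_semi : ∀ x y : M, ∀ s t : ℝ, 0 < s → 0 < t →
      p x y (s + t) = ∫⁻ z, p x z s * p z y t ∂μ)
    (hp_sc : ∀ x : M, ∀ t : ℝ, 0 < t → ∫⁻ y, p x y t ∂μ = 1)
    (C : ℝ) (hC : 2 ≤ C)
    (hLY_lower : ∀ x y : M, ∀ t : ℝ, 0 < t →
      ENNReal.ofReal (C⁻¹ * Real.exp (-(C * dist x y ^ 2) / t)) *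
        (μ (ball x (Real.sqrt t)) * μ (ball y (Real.sqrt t))) ^ (-(1 : ℝ) / 2)
        ≤ p x y t)
    (hLY_upper : ∀ x y : M, ∀ t : ℝ, 0 < t →
      p x y t ≤ ENNReal.ofReal (C * Real.exp (-(dist x y ^ 2) / (C * t))) *
        (μ (ball x (Real.sqrt t)) * μ (ball y (Real.sqrt t))) ^ (-(1 : ℝ) / 2))
    (hdbl : ∀ x : M, ∀ R : ℝ, 0 < R →
      μ (ball x (2 * R)) ≤ ENNReal.ofReal C * μ (ball x R))
    (Ω : Set M) (hΩ : IsOpen Ω)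
    (H : ℝ → ℝ≥0∞)
    (hH : ∀ t : ℝ, H t = ∫⁻ x in Ω, ∫⁻ y in Ω, p x y t ∂μ ∂μ)
    (T : ℝ) (hT : 0 < T)
    (hfin : (∫⁻ x in Ω, μ (ball x (Real.sqrt T) ∩ Ω) / μ (ball x (Real.sqrt T)) ∂μ) < ⊤) :
    ∀ t : ℝ, 0 < t →
      ENNReal.ofReal (C ^ (-2 : ℝ) * Real.exp (-C)) *
          (∫⁻ x in Ω, μ (ball x (Real.sqrt t) ∩ Ω) / μ (ball x (Real.sqrt t)) ∂μ)
        ≤ H t ∧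
      H t ≤
        ENNReal.ofReal (2 * C ^ ((15 : ℝ) / 4) *
            (C * Real.log (2 * C ^ ((7 : ℝ) / 2 + Real.log C / Real.log 2))) ^
              (3 * Real.log C / (4 * Real.log 2))) *
          (∫⁻ x in Ω, μ (ball x (Real.sqrt t) ∩ Ω) / μ (ball x (Real.sqrt t)) ∂μ) := by
  intro t ht
  have : SigmaFinite μ := sigmaFinite_of_ball_lt_top μ fun x R hR => (hball x R hR).2
  have : SecondCountableTopology M :=
    secondCountableTopology_of_ball_pos μ fun x R hR => (hball x R hR).1
  rw [hH t]
  exact ⟨ofReal_mul_lintegral_le_lintegral_heatKernel μ hC hdbl ht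
      (fun x y => hLY_lower x y t ht) Ω,
    lintegral_heatKernel_le μ hball hC hdbl ht (fun x y => hLY_upper x y t ht) Ω⟩
end

section
/- Let m ≥ 1, let (z_i)_{i∈ℕ} be an enumeration of the lattice ℤ^m in ℝ^m, let r₁ ≥ r₂ ≥ r₃ ≥ … > 0 be a decreasing sequence of radii with δ = 1 − 2r₁ > 0, and let Ω = ⋃_{i∈ℕ} B(z_i; r_i) ⊆ ℝ^m, where B(z;r) is the open Euclidean ball of centre z and radius r. Let H_Ω(t) = ∫_Ω ∫_Ω (4πt)^{-m/2} e^{-|x−y|²/(4t)} dy dx be the heat content of Ω in ℝ^m. Then H_Ω(t) < ∞ for all t > 0 if and only if ∑_{i=1}^∞ r_i^{2m} < ∞. -/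
open MeasureTheory Metric ENNReal

/-- The heat content of an open set `Ω ⊆ ℝᵐ` at time `t`, computed with the Euclidean
heat kernel `p(x,y;t) = (4πt)^{-m/2} e^{-|x-y|²/(4t)}`. -/
noncomputable def heatContent {m : ℕ} (Ω : Set (EuclideanSpace ℝ (Fin m))) (t : ℝ) :
    ℝ≥0∞ :=
  ∫⁻ x in Ω, ∫⁻ y in Ω,
    ENNReal.ofReal ((4 * Real.pi * t) ^ (-(m : ℝ) / 2) * Real.exp (-dist x y ^ 2 / (4 * t)))

/-- `z : ℕ → ℝᵐ` is an enumeration of the integer lattice `ℤᵐ ⊆ ℝᵐ`. -/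
def IsLatticeEnum (m : ℕ) (z : ℕ → EuclideanSpace ℝ (Fin m)) : Prop :=
  Function.Injective z ∧
    Set.range z = {x : EuclideanSpace ℝ (Fin m) | ∀ j : Fin m, ∃ k : ℤ, x j = (k : ℝ)}

/-- The Gaussian weights on the integers have a finite sum. -/
theorem tsum_int_gaussian_ne_top {a : ℝ} (ha : 0 < a) :
    ∑' k : ℤ, ENNReal.ofReal (Real.exp (-a * (k : ℝ) ^ 2)) ≠ ⊤ := by
  have hnat : Summable fun n : ℕ => Real.exp (-a * (n : ℝ) ^ 2) := by
    refine Summable.of_nonneg_of_le (fun n => (Real.exp_pos _).le) (fun n => ?_)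
      (summable_geometric_of_lt_one (Real.exp_pos (-a)).le (by rw [Real.exp_lt_one_iff]; linarith))
    rw [← Real.exp_nat_mul, Real.exp_le_exp]
    have hn : (n : ℝ) ≤ (n : ℝ) ^ 2 := by exact_mod_cast Nat.le_self_pow two_ne_zero n
    nlinarith
  have hint : Summable fun k : ℤ => Real.exp (-a * (k : ℝ) ^ 2) :=
    Summable.of_nat_of_neg (by simpa using hnat) (by simpa using hnat)
  exact hint.tsum_ofReal_ne_top

/-- The Gaussian weights on the lattice `ℤⁿ` have a finite sum. -/
theorem tsum_pi_int_gaussian_ne_top {a : ℝ} (ha : 0 < a) (n : ℕ) :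
    ∑' k : Fin n → ℤ, ENNReal.ofReal (Real.exp (-a * ∑ j, (k j : ℝ) ^ 2)) ≠ ⊤ := by
  induction n with
  | zero => simp
  | succ n ih =>
    rw [← (Fin.consEquiv fun _ : Fin (n + 1) => ℤ).tsum_eq, ENNReal.tsum_prod']
    have hsplit (k : ℤ) (l : Fin n → ℤ) :
        ENNReal.ofReal (Real.exp (-a * ∑ j,
          ((Fin.consEquiv fun _ : Fin (n + 1) => ℤ) (k, l) j : ℝ) ^ 2)) =
        ENNReal.ofReal (Real.exp (-a * (k : ℝ) ^ 2)) *
          ENNReal.ofReal (Real.exp (-a * ∑ j, (l j : ℝ) ^ 2)) := by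
      rw [← ENNReal.ofReal_mul (Real.exp_pos _).le, ← Real.exp_add]
      simp [Fin.consEquiv, Fin.sum_univ_succ, mul_add]
    simp_rw [hsplit, ENNReal.tsum_mul_left, ENNReal.tsum_mul_right]
    exact ENNReal.mul_ne_top (tsum_int_gaussian_ne_top ha) ih

namespace IsLatticeEnum

variable {m : ℕ} {z : ℕ → EuclideanSpace ℝ (Fin m)}

theorem exists_int_coords (hz : IsLatticeEnum m z) :
    ∃ c : ℕ → Fin m → ℤ, ∀ i j, z i j = (c i j : ℝ) := by
  have h (i : ℕ) : ∀ j, ∃ k : ℤ, z i j = (k : ℝ) := by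
    have hi : z i ∈ Set.range z := ⟨i, rfl⟩
    rwa [hz.2] at hi
  choose c hc using h
  exact ⟨c, hc⟩

theorem one_le_dist (hz : IsLatticeEnum m z) {i j : ℕ} (hij : i ≠ j) :
    1 ≤ dist (z i) (z j) := by
  obtain ⟨c, hc⟩ := hz.exists_int_coords
  obtain ⟨l, hl⟩ : ∃ l, c i l ≠ c j l := by
    by_contra! h
    exact hij (hz.1 (by ext l; rw [hc, hc, h l]))
  have hcoord : |z i l - z j l| ≤ dist (z i) (z j) := by
    simpa [dist_eq_norm] using PiLp.norm_apply_le (z i - z j) l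
  refine le_trans ?_ hcoord
  rw [hc, hc]
  have habs : (1 : ℤ) ≤ |c i l - c j l| := Int.one_le_abs (sub_ne_zero.mpr hl)
  have hcast : ((1 : ℤ) : ℝ) ≤ ((|c i l - c j l| : ℤ) : ℝ) := Int.cast_le.mpr habs
  simpa using hcast

theorem tsum_gaussian_le (hz : IsLatticeEnum m z) (a : ℝ) (i : ℕ) :
    ∑' j, ENNReal.ofReal (Real.exp (-a * dist (z i) (z j) ^ 2)) ≤
      ∑' k : Fin m → ℤ, ENNReal.ofReal (Real.exp (-a * ∑ l, (k l : ℝ) ^ 2)) := by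
  obtain ⟨c, hc⟩ := hz.exists_int_coords
  have hinj : Function.Injective fun j => c i - c j := by
    intro j j' h
    have hcc : c j = c j' := by simpa using h
    exact hz.1 (by ext l; rw [hc, hc, hcc])
  refine le_trans (le_of_eq ?_) (ENNReal.tsum_comp_le_tsum_of_injective hinj _)
  refine tsum_congr fun j => ?_
  rw [EuclideanSpace.dist_eq, Real.sq_sqrt (Finset.sum_nonneg fun _ _ => sq_nonneg _)]
  simp [hc, Real.dist_eq]

end IsLatticeEnum

/-- A symmetric kernel with uniformly bounded row sums is bounded as a quadratic form
on square-summable sequences. -/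
theorem tsum_mul_mul_kernel_le {ι : Type*} (v : ι → ℝ≥0∞) (k : ι → ι → ℝ≥0∞)
    (hk : ∀ i j, k i j = k j i) {S : ℝ≥0∞} (hS : ∀ i, ∑' j, k i j ≤ S) :
    ∑' i, ∑' j, v i * v j * k i j ≤ 2 * (∑' i, v i ^ 2) * S := by
  have hrow : ∑' i, ∑' j, v i ^ 2 * k i j ≤ (∑' i, v i ^ 2) * S := by
    rw [← ENNReal.tsum_mul_right]
    refine ENNReal.tsum_le_tsum fun i => ?_
    rw [ENNReal.tsum_mul_left]
    gcongr
    exact hS i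
  have hamgm (x y : ℝ≥0∞) : x * y ≤ x ^ 2 + y ^ 2 := by
    rcases le_total x y with h | h
    · exact le_add_left (by rw [sq]; gcongr)
    · exact le_add_right (by rw [sq]; gcongr)
  calc ∑' i, ∑' j, v i * v j * k i j
      ≤ ∑' i, ∑' j, (v i ^ 2 * k i j + v j ^ 2 * k j i) := by
        refine ENNReal.tsum_le_tsum fun i => ENNReal.tsum_le_tsum fun j => ?_
        rw [hk j i, ← add_mul]
        gcongr
        exact hamgm _ _
    _ = (∑' i, ∑' j, v i ^ 2 * k i j) + ∑' j, ∑' i, v j ^ 2 * k j i := by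
        simp_rw [ENNReal.tsum_add]
        rw [ENNReal.tsum_comm (f := fun i j => v j ^ 2 * k j i)]
    _ ≤ 2 * (∑' i, v i ^ 2) * S := by
        rw [mul_assoc, two_mul]
        gcongr

theorem tsum_volume_ball_sq_ne_top_iff {m : ℕ}
    (z : ℕ → EuclideanSpace ℝ (Fin m)) {r : ℕ → ℝ} (hr : ∀ i, 0 < r i) :
    ∑' i, volume (ball (z i) (r i)) ^ 2 ≠ ⊤ ↔ Summable fun i => r i ^ (2 * m) := by
  set ω := volume (ball (0 : EuclideanSpace ℝ (Fin m)) 1)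
  have hω0 : ω ^ 2 ≠ 0 := pow_ne_zero 2 (measure_ball_pos volume 0 one_pos).ne'
  have hωtop : ω ^ 2 ≠ ⊤ := ENNReal.pow_ne_top measure_ball_lt_top.ne
  have hvol (i : ℕ) :
      volume (ball (z i) (r i)) ^ 2 = ENNReal.ofReal (r i ^ (2 * m)) * ω ^ 2 := by
    rw [Measure.addHaar_ball_of_pos volume (z i) (hr i), mul_pow, finrank_euclideanSpace_fin,
      ← ENNReal.ofReal_pow (pow_nonneg (hr i).le _), ← pow_mul, mul_comm m 2]
  simp_rw [hvol, ENNReal.tsum_mul_right]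
  constructor
  · intro h
    have hsum : ∑' i, ENNReal.ofReal (r i ^ (2 * m)) ≠ ⊤ := fun htop =>
      h (by rw [htop, ENNReal.top_mul hω0])
    refine (ENNReal.summable_toReal hsum).congr fun i => ?_
    rw [ENNReal.toReal_ofReal (pow_nonneg (hr i).le _)]
  · exact fun h => ENNReal.mul_ne_top h.tsum_ofReal_ne_top hωtop

theorem tsum_volume_ball_sq_le_heatContent {m : ℕ}
    {z : ℕ → EuclideanSpace ℝ (Fin m)} {r : ℕ → ℝ}
    (hdisj : Pairwise (Function.onFun Disjoint fun i => ball (z i) (r i)))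
    {R : ℝ} (hR : ∀ i, 2 * r i ≤ R) {t : ℝ} (ht : 0 < t) :
    ENNReal.ofReal ((4 * Real.pi * t) ^ (-(m : ℝ) / 2) * Real.exp (-R ^ 2 / (4 * t))) *
        ∑' i, volume (ball (z i) (r i)) ^ 2 ≤
      heatContent (⋃ i, ball (z i) (r i)) t := by
  rw [heatContent, lintegral_iUnion (fun _ => measurableSet_ball) hdisj, ← ENNReal.tsum_mul_left]
  refine ENNReal.tsum_le_tsum fun i => ?_
  rw [sq (volume _), ← mul_assoc, ← setLIntegral_const]
  refine setLIntegral_mono' measurableSet_ball fun x hx => ?_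
  refine le_trans ?_ (lintegral_mono_set (Set.subset_iUnion (fun i => ball (z i) (r i)) i))
  rw [← setLIntegral_const]
  refine setLIntegral_mono' measurableSet_ball fun y hy => ?_
  have hxy : dist x y ≤ R := by
    have h := dist_triangle_right x y (z i)
    rw [mem_ball] at hx hy
    linarith [hR i]
  gcongr

theorem heatContent_iUnion_ball_le {m : ℕ} {z : ℕ → EuclideanSpace ℝ (Fin m)} {r : ℕ → ℝ}
    {δ : ℝ} (hδ : 0 ≤ δ)
    (hsep : ∀ i j, ∀ x ∈ ball (z i) (r i), ∀ y ∈ ball (z j) (r j),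
      δ * dist (z i) (z j) ≤ dist x y)
    {t : ℝ} (ht : 0 < t) :
    heatContent (⋃ i, ball (z i) (r i)) t ≤
      ENNReal.ofReal ((4 * Real.pi * t) ^ (-(m : ℝ) / 2)) *
        ∑' i, ∑' j, volume (ball (z i) (r i)) * volume (ball (z j) (r j)) *
          ENNReal.ofReal (Real.exp (-(δ ^ 2 / (4 * t)) * dist (z i) (z j) ^ 2)) := by
  set C : ℝ≥0∞ := ENNReal.ofReal ((4 * Real.pi * t) ^ (-(m : ℝ) / 2))
  have hker (i j : ℕ) (x) (hx : x ∈ ball (z i) (r i)) (y) (hy : y ∈ ball (z j) (r j)) :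
      ENNReal.ofReal ((4 * Real.pi * t) ^ (-(m : ℝ) / 2) *
        Real.exp (-dist x y ^ 2 / (4 * t))) ≤
      C * ENNReal.ofReal (Real.exp (-(δ ^ 2 / (4 * t)) * dist (z i) (z j) ^ 2)) := by
    rw [ENNReal.ofReal_mul (by positivity)]
    refine mul_le_mul_right (ENNReal.ofReal_le_ofReal (Real.exp_le_exp.mpr ?_)) _
    have hsq := pow_le_pow_left₀ (mul_nonneg hδ dist_nonneg) (hsep i j x hx y hy) 2
    calc -dist x y ^ 2 / (4 * t) ≤ -(δ * dist (z i) (z j)) ^ 2 / (4 * t) := by gcongr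
      _ = -(δ ^ 2 / (4 * t)) * dist (z i) (z j) ^ 2 := by ring
  rw [heatContent, ← ENNReal.tsum_mul_left]
  refine (lintegral_iUnion_le _ _).trans (ENNReal.tsum_le_tsum fun i => ?_)
  have hinner : ∀ x ∈ ball (z i) (r i),
      ∫⁻ y in ⋃ j, ball (z j) (r j), ENNReal.ofReal ((4 * Real.pi * t) ^ (-(m : ℝ) / 2) *
        Real.exp (-dist x y ^ 2 / (4 * t))) ≤
      ∑' j, C * ENNReal.ofReal (Real.exp (-(δ ^ 2 / (4 * t)) * dist (z i) (z j) ^ 2)) *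
        volume (ball (z j) (r j)) := by
    intro x hx
    refine (lintegral_iUnion_le _ _).trans (ENNReal.tsum_le_tsum fun j => ?_)
    rw [← setLIntegral_const]
    exact setLIntegral_mono' measurableSet_ball fun y hy => hker i j x hx y hy
  refine (setLIntegral_mono' measurableSet_ball hinner).trans (le_of_eq ?_)
  rw [setLIntegral_const, ← ENNReal.tsum_mul_right, ← ENNReal.tsum_mul_left]
  exact tsum_congr fun j => by ring

/-- Theorem 3(i): for `Ω` a union of disjoint balls `B(z_i;r_i)` centred at the points of
`ℤᵐ` with decreasing radii and `δ = 1 - 2 r₁ > 0`, the heat content `H_Ω(t)` is finite for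
all `t > 0` if and only if `∑ r_i^{2m} < ∞`. -/
theorem heat_content_lattice_balls_finite_iff
    (m : ℕ) (hm : 1 ≤ m)
    (z : ℕ → EuclideanSpace ℝ (Fin m)) (hz : IsLatticeEnum m z)
    (r : ℕ → ℝ) (hrpos : ∀ i, 0 < r i) (hrdec : Antitone r)
    (hδ : 0 < 1 - 2 * r 0)
    (Ω : Set (EuclideanSpace ℝ (Fin m))) (hΩ : Ω = ⋃ i : ℕ, ball (z i) (r i)) :
    (∀ t : ℝ, 0 < t → heatContent Ω t < ⊤) ↔ Summable (fun i : ℕ => r i ^ (2 * m)) := by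
  subst hΩ
  have hr0 (i : ℕ) : r i ≤ r 0 := hrdec (Nat.zero_le i)
  rw [← tsum_volume_ball_sq_ne_top_iff z hrpos]
  constructor
  · intro hfin
    have hdisj : Pairwise (Function.onFun Disjoint fun i => ball (z i) (r i)) :=
      fun i j hij => ball_disjoint_ball (by linarith [hz.one_le_dist hij, hr0 i, hr0 j])
    have hle := (tsum_volume_ball_sq_le_heatContent hdisj (R := 1)
      (fun i => by linarith [hr0 i]) one_pos).trans_lt (hfin 1 one_pos)
    intro htop
    rw [htop, ENNReal.mul_top (ENNReal.ofReal_pos.mpr (by positivity)).ne'] at hle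
    exact lt_irrefl _ hle
  · intro hsum t ht
    have hsep : ∀ i j, ∀ x ∈ ball (z i) (r i), ∀ y ∈ ball (z j) (r j),
        (1 - 2 * r 0) * dist (z i) (z j) ≤ dist x y := by
      intro i j x hx y hy
      rcases eq_or_ne i j with rfl | hij
      · simp
      · rw [mem_ball'] at hx
        rw [mem_ball] at hy
        have htri := dist_triangle4 (z i) x y (z j)
        nlinarith [hz.one_le_dist hij, hr0 i, hr0 j, hrpos 0]
    have ha : 0 < (1 - 2 * r 0) ^ 2 / (4 * t) := by positivity
    refine (heatContent_iUnion_ball_le hδ.le hsep ht).trans_lt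
      (ENNReal.mul_lt_top ENNReal.ofReal_lt_top ?_)
    refine (tsum_mul_mul_kernel_le _ _ (fun i j => by rw [dist_comm])
      fun i => hz.tsum_gaussian_le _ i).trans_lt ?_
    exact ENNReal.mul_lt_top (ENNReal.mul_lt_top (by simp) hsum.lt_top)
      (tsum_pi_int_gaussian_ne_top ha m).lt_top
end

section
/- Let m ≥ 2, 0 < a ≤ 1/4, and 1/(2m) < α < 1/m. Let (z_i)_{i∈ℕ} be an enumeration of ℤ^m in ℝ^m, set r_i = a i^{-α}, and let Ω = ⋃_{i∈ℕ} B(z_i; r_i). Then, as t ↓ 0, H_Ω(t) − c_{α,m} t^{(mα−1)/(2α)} = O(1), where c_{α,m} = 2^{m−1−1/α} π^{-m/2} α^{-1} Γ((2mα−1)/(2α)) a^{1/α} ∫_{B(0;1)} ∫_{B(0;1)} |x−y|^{(1−2mα)/α} dy dx and Γ is the Gamma function. -/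
open MeasureTheory Metric ENNReal

/-- The Euclidean heat kernel in dimension `m` as a function of time and distance. -/
noncomputable def gaussKernel (m : ℕ) (t d : ℝ) : ℝ :=
  (4 * Real.pi * t) ^ (-(m : ℝ) / 2) * Real.exp (-d ^ 2 / (4 * t))

lemma gaussKernel_nonneg (m : ℕ) {t : ℝ} (ht : 0 < t) (d : ℝ) : 0 ≤ gaussKernel m t d := by
  unfold gaussKernel
  positivity

lemma continuous_gaussKernel (m : ℕ) (t : ℝ) : Continuous (gaussKernel m t) := by
  unfold gaussKernel
  fun_prop

lemma measurable_gaussKernel_dist {m : ℕ} (t : ℝ) :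
    Measurable fun p : EuclideanSpace ℝ (Fin m) × EuclideanSpace ℝ (Fin m) ↦
      ENNReal.ofReal (gaussKernel m t (dist p.1 p.2)) :=
  (((continuous_gaussKernel m t).comp continuous_dist).measurable).ennreal_ofReal

lemma heatContent_eq {m : ℕ} (Ω : Set (EuclideanSpace ℝ (Fin m))) (t : ℝ) :
    heatContent Ω t = ∫⁻ x in Ω, ∫⁻ y in Ω, ENNReal.ofReal (gaussKernel m t (dist x y)) :=
  rfl

lemma heatContent_mono {m : ℕ} {Ω Ω' : Set (EuclideanSpace ℝ (Fin m))} (h : Ω ⊆ Ω') (t : ℝ) :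
    heatContent Ω t ≤ heatContent Ω' t := by
  rw [heatContent_eq, heatContent_eq]
  exact (lintegral_mono fun x ↦ lintegral_mono_set h).trans (lintegral_mono_set h)

lemma lintegral_gaussKernel {m : ℕ} {t : ℝ} (ht : 0 < t) (x : EuclideanSpace ℝ (Fin m)) :
    ∫⁻ y, ENNReal.ofReal (gaussKernel m t (dist x y)) = 1 := by
  have hb : 0 < 1 / (4 * t) := by positivity
  have h1 := GaussianFourier.integral_rexp_neg_mul_sq_norm
    (V := EuclideanSpace ℝ (Fin m)) hb
  have hpos : 0 < 4 * Real.pi * t := by positivity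
  have h2 : ∫ y : EuclideanSpace ℝ (Fin m), gaussKernel m t ‖y‖ = 1 := by
    have : ∀ y : EuclideanSpace ℝ (Fin m), gaussKernel m t ‖y‖ =
        (4 * Real.pi * t) ^ (-(m : ℝ) / 2) * Real.exp (-(1 / (4 * t)) * ‖y‖ ^ 2) := by
      intro y
      unfold gaussKernel
      congr 2
      ring
    simp_rw [this]
    rw [integral_const_mul, h1, finrank_euclideanSpace_fin,
      show Real.pi / (1 / (4 * t)) = 4 * Real.pi * t by field_simp, ← Real.rpow_add hpos]
    rw [show -(m : ℝ) / 2 + m / 2 = 0 by ring, Real.rpow_zero]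
  have h3 : Integrable fun y : EuclideanSpace ℝ (Fin m) ↦ gaussKernel m t ‖y‖ :=
    .of_integral_ne_zero (by rw [h2]; exact one_ne_zero)
  have h4 : ∫⁻ y : EuclideanSpace ℝ (Fin m), ENNReal.ofReal (gaussKernel m t ‖y‖) = 1 := by
    rw [← ofReal_integral_eq_lintegral_ofReal h3
      (Filter.Eventually.of_forall fun y ↦ gaussKernel_nonneg m ht _), h2, ENNReal.ofReal_one]
  rw [← h4, ← lintegral_sub_right_eq_self
    (fun y : EuclideanSpace ℝ (Fin m) ↦ ENNReal.ofReal (gaussKernel m t ‖y‖)) x]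
  simp_rw [dist_comm x, dist_eq_norm]

lemma heatContent_le_volume {m : ℕ} (Ω : Set (EuclideanSpace ℝ (Fin m))) {t : ℝ} (ht : 0 < t) :
    heatContent Ω t ≤ volume Ω := by
  rw [heatContent_eq]
  calc _ ≤ ∫⁻ _ in Ω, (1 : ℝ≥0∞) := lintegral_mono fun x ↦
        (setLIntegral_le_lintegral _ _).trans (lintegral_gaussKernel ht x).le
    _ = volume Ω := by simp

lemma setLIntegral_ball_eq {m : ℕ} (z : EuclideanSpace ℝ (Fin m)) {ρ : ℝ} (hρ : 0 < ρ)
    (f : EuclideanSpace ℝ (Fin m) → ℝ≥0∞) :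
    ∫⁻ x in ball z ρ, f x = ENNReal.ofReal (ρ ^ m) * ∫⁻ x in ball 0 1, f (z + ρ • x) := by
  have hemb : MeasurableEmbedding fun x : EuclideanSpace ℝ (Fin m) ↦ ρ • x :=
    (MeasurableEquiv.smul₀ ρ hρ.ne').measurableEmbedding
  have hpre : (fun x : EuclideanSpace ℝ (Fin m) ↦ ρ • x) ⁻¹' ball 0 ρ = ball 0 1 := by
    ext x
    simp [norm_smul, abs_of_pos hρ, hρ]
  have hpre' : (fun x : EuclideanSpace ℝ (Fin m) ↦ z + x) ⁻¹' ball z ρ = ball 0 ρ := by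
    ext x
    simp
  have hmap := Measure.map_addHaar_smul (volume : Measure (EuclideanSpace ℝ (Fin m))) hρ.ne'
  rw [← (measurePreserving_add_left volume z).setLIntegral_comp_preimage_emb
    (measurableEmbedding_addLeft z), hpre']
  have h1 : ∫⁻ x in ball 0 1, f (z + ρ • x) =
      ENNReal.ofReal |(ρ ^ m)⁻¹| * ∫⁻ x in ball 0 ρ, f (z + x) := by
    rw [← hpre, ← hemb.lintegral_map (fun x ↦ f (z + x)), ← hemb.restrict_map, hmap,
      Measure.restrict_smul, lintegral_smul_measure, finrank_euclideanSpace_fin, smul_eq_mul]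
  rw [h1, ← mul_assoc, ← ENNReal.ofReal_mul (by positivity), abs_of_pos (by positivity),
    mul_inv_cancel₀ (by positivity), ENNReal.ofReal_one, one_mul]

/-- Scaling and translation behaviour of the heat content of a ball. -/
lemma heatContent_ball {m : ℕ} (z : EuclideanSpace ℝ (Fin m)) {ρ : ℝ} (hρ : 0 < ρ) (t : ℝ) :
    heatContent (ball z ρ) t = ∫⁻ x in ball (0 : EuclideanSpace ℝ (Fin m)) 1,
      ∫⁻ y in ball (0 : EuclideanSpace ℝ (Fin m)) 1,
        ENNReal.ofReal (ρ ^ (2 * m) * gaussKernel m t (ρ * dist x y)) := by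
  have hd (x y : EuclideanSpace ℝ (Fin m)) : dist (z + ρ • x) (z + ρ • y) = ρ * dist x y := by
    rw [dist_add_left, dist_smul₀, Real.norm_of_nonneg hρ.le]
  rw [heatContent_eq, setLIntegral_ball_eq z hρ, ← lintegral_const_mul' _ _ ENNReal.ofReal_ne_top]
  refine lintegral_congr fun x ↦ ?_
  rw [setLIntegral_ball_eq z hρ, ← mul_assoc, ← ENNReal.ofReal_mul (by positivity),
    ← lintegral_const_mul' _ _ ENNReal.ofReal_ne_top]
  refine lintegral_congr fun y ↦ ?_
  rw [← ENNReal.ofReal_mul (by positivity), hd]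
  congr 2
  ring

lemma heatContent_ball_eq_zero_center {m : ℕ} (z : EuclideanSpace ℝ (Fin m)) {ρ : ℝ} (hρ : 0 < ρ)
    (t : ℝ) : heatContent (ball z ρ) t = heatContent (ball (0 : EuclideanSpace ℝ (Fin m)) ρ) t := by
  rw [heatContent_ball z hρ, heatContent_ball 0 hρ]

lemma lintegral_Ioi_eq_tsum (f : ℝ → ℝ≥0∞) :
    ∫⁻ s in Set.Ioi (0 : ℝ), f s = ∑' i : ℕ, ∫⁻ s in Set.Ioc (i : ℝ) (i + 1), f s := by
  have h : ⋃ i : ℕ, Set.Ioc (i : ℝ) (i + 1) = Set.Ioi (0 : ℝ) := by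
    have := iUnion_Ioc_map_succ_eq_Ioi (f := fun i : ℕ ↦ (i : ℝ)) (by simp)
      (fun ⟨b, hb⟩ ↦ by
        obtain ⟨n, hn⟩ := exists_nat_gt b
        exact (hb ⟨n, rfl⟩).not_gt hn)
    simpa using this
  rw [← h, lintegral_iUnion (fun _ ↦ measurableSet_Ioc)]
  have := (Nat.mono_cast (α := ℝ)).pairwise_disjoint_on_Ioc_succ
  simpa using this

/-- Integral comparison for a function that is antitone on the positive half-line. -/
lemma tsum_le_lintegral_of_antitoneOn {f : ℝ → ℝ≥0∞} (hf : AntitoneOn f (Set.Ioi 0)) :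
    ∑' i : ℕ, f (i + 1) ≤ ∫⁻ s in Set.Ioi (0 : ℝ), f s := by
  rw [lintegral_Ioi_eq_tsum]
  refine ENNReal.tsum_le_tsum fun i ↦ ?_
  calc f (i + 1) = ∫⁻ _ in Set.Ioc (i : ℝ) (i + 1), f (i + 1) := by simp
    _ ≤ _ := setLIntegral_mono' measurableSet_Ioc fun s hs ↦
      hf (show (0 : ℝ) < s from i.cast_nonneg.trans_lt hs.1) (by simp; positivity) hs.2

lemma lintegral_le_tsum_of_antitoneOn {f : ℝ → ℝ≥0∞} (hf : AntitoneOn f (Set.Ioi 0)) :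
    ∫⁻ s in Set.Ioi (0 : ℝ), f s ≤ (∫⁻ s in Set.Ioc (0 : ℝ) 1, f s) + ∑' i : ℕ, f (i + 1) := by
  rw [lintegral_Ioi_eq_tsum, tsum_eq_zero_add' ENNReal.summable]
  simp only [Nat.cast_zero, zero_add]
  gcongr with i
  calc _ ≤ ∫⁻ _ in Set.Ioc ((i + 1 : ℕ) : ℝ) ((i + 1 : ℕ) + 1), f (i + 1) :=
        setLIntegral_mono' measurableSet_Ioc fun s hs ↦
          hf (by simp; positivity) (show (0 : ℝ) < s from (Nat.cast_nonneg _).trans_lt hs.1)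
            (by have := hs.1.le; push_cast at this; exact this)
    _ = _ := by simp

lemma lintegral_Ioi_rpow_mul_exp_neg_rpow {α σ b : ℝ} (hα : 0 < α) (hσ : 0 < σ) (hb : 0 < b) :
    ∫⁻ s in Set.Ioi (0 : ℝ),
      ENNReal.ofReal (s ^ (-(2 * α * σ) - 1) * Real.exp (-(b * s ^ (-(2 * α))))) =
    ENNReal.ofReal ((2 * α)⁻¹ * b ^ (-σ) * Real.Gamma σ) := by
  have h1 := integral_comp_rpow_Ioi (fun u : ℝ ↦ u ^ (σ - 1) * Real.exp (-(b * u)))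
    (p := -(2 * α)) (by linarith)
  rw [Real.integral_rpow_mul_exp_neg_mul_Ioi hσ hb] at h1
  have h2 : ∫ s in Set.Ioi (0 : ℝ), s ^ (-(2 * α * σ) - 1) * Real.exp (-(b * s ^ (-(2 * α)))) =
      (2 * α)⁻¹ * b ^ (-σ) * Real.Gamma σ := by
    rw [one_div, Real.inv_rpow hb.le, ← Real.rpow_neg hb.le] at h1
    rw [mul_assoc (2 * α)⁻¹, ← h1, ← integral_const_mul]
    refine setIntegral_congr_fun measurableSet_Ioi fun s hs ↦ ?_
    have hs : 0 < s := hs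
    simp only [smul_eq_mul, abs_neg, abs_of_pos (show 0 < 2 * α by positivity)]
    rw [← Real.rpow_mul hs.le, show -(2 * α * σ) - 1 = (-(2 * α) - 1) + -(2 * α) * (σ - 1) by ring,
      Real.rpow_add hs]
    field_simp
  rw [← h2]
  refine (ofReal_integral_eq_lintegral_ofReal (.of_integral_ne_zero ?_) ?_).symm
  · rw [h2]
    have := Real.Gamma_pos_of_pos hσ
    positivity
  · refine (ae_restrict_iff' measurableSet_Ioi).2 (Filter.Eventually.of_forall fun s hs ↦ ?_)
    have hs : 0 < s := hs
    simp only [Pi.zero_apply]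
    positivity

lemma lintegral_Ioi_gaussKernel_rpow (m : ℕ) {a α t d : ℝ} (ha : 0 < a) (hα : 0 < α)
    (hm : 0 < (m : ℝ) - 1 / (2 * α)) (ht : 0 < t) (hd : 0 < d) :
    ∫⁻ s in Set.Ioi (0 : ℝ),
      ENNReal.ofReal ((a * s ^ (-α)) ^ (2 * m) * gaussKernel m t (a * s ^ (-α) * d)) =
    ENNReal.ofReal (2 ^ ((m : ℝ) - 1 - 1 / α) * Real.pi ^ (-(m : ℝ) / 2) * α⁻¹ *
      Real.Gamma ((2 * (m : ℝ) * α - 1) / (2 * α)) * a ^ (1 / α) *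
      t ^ (((m : ℝ) * α - 1) / (2 * α))) *
      ENNReal.ofReal (d ^ ((1 - 2 * (m : ℝ) * α) / α)) := by
  set σ : ℝ := (m : ℝ) - 1 / (2 * α) with hσ
  set b : ℝ := a ^ 2 * d ^ 2 / (4 * t) with hb
  have hb0 : 0 < b := by positivity
  have hασ : 2 * α * σ = 2 * α * m - 1 := by rw [hσ]; field_simp
  have key : ∀ s ∈ Set.Ioi (0 : ℝ),
      ENNReal.ofReal ((a * s ^ (-α)) ^ (2 * m) * gaussKernel m t (a * s ^ (-α) * d)) =
      ENNReal.ofReal ((4 * Real.pi * t) ^ (-(m : ℝ) / 2) * a ^ (2 * m)) *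
        ENNReal.ofReal (s ^ (-(2 * α * σ) - 1) * Real.exp (-(b * s ^ (-(2 * α))))) := by
    intro s hs
    have hs : 0 < s := hs
    rw [← ENNReal.ofReal_mul (by positivity), gaussKernel, hασ]
    have e1 : (s ^ (-α)) ^ (2 * m) = s ^ (-(2 * α * m - 1) - 1) := by
      rw [← Real.rpow_natCast, ← Real.rpow_mul hs.le]
      congr 1
      push_cast
      ring
    have e2 : (s ^ (-α)) ^ 2 = s ^ (-(2 * α)) := by
      rw [← Real.rpow_natCast, ← Real.rpow_mul hs.le]
      congr 1
      push_cast
      ring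
    rw [← e1, ← e2, show -(a * s ^ (-α) * d) ^ 2 / (4 * t) = -(b * (s ^ (-α)) ^ 2) by
      rw [hb]; ring]
    congr 1
    ring
  rw [setLIntegral_congr_fun measurableSet_Ioi key, lintegral_const_mul' _ _ ENNReal.ofReal_ne_top,
    lintegral_Ioi_rpow_mul_exp_neg_rpow hα hm hb0, ← ENNReal.ofReal_mul (by positivity),
    ← ENNReal.ofReal_mul (by
      have : 0 < Real.Gamma ((2 * (m : ℝ) * α - 1) / (2 * α)) := by
        refine Real.Gamma_pos_of_pos ?_
        convert hm using 1
        rw [hσ]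
        field_simp
      positivity),
    show (2 * (m : ℝ) * α - 1) / (2 * α) = σ by rw [hσ]; field_simp]
  congr 1
  have e3 : (4 * Real.pi * t) ^ (-(m : ℝ) / 2) * a ^ (2 * m) * ((2 : ℝ)⁻¹ * b ^ (-σ)) =
      2 ^ ((m : ℝ) - 1 - 1 / α) * Real.pi ^ (-(m : ℝ) / 2) * a ^ (1 / α) *
      t ^ (((m : ℝ) * α - 1) / (2 * α)) * d ^ ((1 - 2 * (m : ℝ) * α) / α) := by
    have l4 : Real.log 4 = 2 * Real.log 2 := by
      rw [show (4 : ℝ) = 2 ^ 2 by norm_num, Real.log_pow]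
      norm_num
    refine Real.log_injOn_pos (Set.mem_Ioi.2 (by positivity)) (Set.mem_Ioi.2 (by positivity)) ?_
    have p := Real.pi_pos
    rw [Real.log_mul (by positivity) (by positivity), Real.log_mul (by positivity) (by positivity),
      Real.log_mul (by positivity) (by positivity), Real.log_rpow (by positivity),
      Real.log_rpow (by positivity), Real.log_mul (by positivity) (by positivity),
      Real.log_mul (by positivity) (by positivity), Real.log_inv, Real.log_pow, hb,
      Real.log_div (by positivity) (by positivity), Real.log_mul (by positivity) (by positivity),
      Real.log_mul (by positivity) (by positivity), Real.log_pow, Real.log_pow,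
      Real.log_mul (by positivity) (by positivity), Real.log_mul (by positivity) (by positivity),
      Real.log_mul (by positivity) (by positivity), Real.log_mul (by positivity) (by positivity),
      Real.log_rpow (by positivity), Real.log_rpow (by positivity), Real.log_rpow (by positivity),
      Real.log_rpow (by positivity), Real.log_rpow (by positivity), l4, hσ]
    push_cast
    field_simp
    ring
  rw [mul_inv]
  linear_combination (α⁻¹ * Real.Gamma σ) * e3

/-- The Riesz potential of the unit ball is finite, uniformly in the base point. -/
lemma exists_lintegral_ball_rpow_le {m : ℕ} (hm : 2 ≤ m) {β : ℝ} (hβ : -(m : ℝ) < β) :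
    ∃ M : ℝ≥0∞, M ≠ ⊤ ∧ ∀ x ∈ ball (0 : EuclideanSpace ℝ (Fin m)) 1,
      ∫⁻ y in ball (0 : EuclideanSpace ℝ (Fin m)) 1, ENNReal.ofReal (‖x - y‖ ^ β) ≤ M := by
  have : Nonempty (Fin m) := ⟨⟨0, by omega⟩⟩
  let g : ℝ → ℝ := (Set.Iio 2).indicator (· ^ β)
  have hg : Integrable fun w : EuclideanSpace ℝ (Fin m) ↦ g ‖w‖ := by
    rw [integrable_fun_norm_addHaar, finrank_euclideanSpace_fin]
    have h1 : IntegrableOn (fun y : ℝ ↦ y ^ ((m : ℝ) - 1 + β)) (Set.Ioo 0 2) :=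
      (intervalIntegral.integrableOn_Ioo_rpow_iff two_pos).2 (by linarith)
    have h2 : Integrable ((Set.Ioo (0 : ℝ) 2).indicator fun y : ℝ ↦ y ^ ((m : ℝ) - 1 + β)) :=
      h1.integrable_indicator measurableSet_Ioo
    refine h2.integrableOn.congr_fun (fun y hy ↦ ?_) measurableSet_Ioi
    have hy : 0 < y := hy
    by_cases h : y < 2
    · simp only [g, Set.indicator_of_mem (show y ∈ Set.Ioo 0 2 from ⟨hy, h⟩),
        Set.indicator_of_mem (show y ∈ Set.Iio 2 from h), smul_eq_mul]
      rw [Real.rpow_add hy, ← Real.rpow_natCast, Nat.cast_sub (by omega), Nat.cast_one]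
    · simp [g, h]
  refine ⟨∫⁻ w : EuclideanSpace ℝ (Fin m), ENNReal.ofReal (g ‖w‖), hg.lintegral_lt_top.ne,
    fun x hx ↦ ?_⟩
  rw [← lintegral_sub_left_eq_self (fun w : EuclideanSpace ℝ (Fin m) ↦ ENNReal.ofReal (g ‖w‖)) x]
  refine (setLIntegral_mono' measurableSet_ball fun y hy ↦ ?_).trans (setLIntegral_le_lintegral _ _)
  have : ‖x - y‖ < 2 := by
    rw [mem_ball_zero_iff] at hx hy
    linarith [norm_sub_le x y]
  simp [g, this]

/-- The Riesz energy of the unit ball, as a lower integral. -/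
lemma ofReal_integral_ball_rpow {m : ℕ} (hm : 2 ≤ m) {β : ℝ} (hβ : -(m : ℝ) < β) :
    ENNReal.ofReal (∫ x in ball (0 : EuclideanSpace ℝ (Fin m)) 1,
      ∫ y in ball (0 : EuclideanSpace ℝ (Fin m)) 1, ‖x - y‖ ^ β) =
    ∫⁻ x in ball (0 : EuclideanSpace ℝ (Fin m)) 1,
      ∫⁻ y in ball (0 : EuclideanSpace ℝ (Fin m)) 1, ENNReal.ofReal (‖x - y‖ ^ β) := by
  obtain ⟨M, hM, hle⟩ := exists_lintegral_ball_rpow_le hm hβ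
  have hmeas : Measurable fun p : EuclideanSpace ℝ (Fin m) × EuclideanSpace ℝ (Fin m) ↦
      ENNReal.ofReal (‖p.1 - p.2‖ ^ β) := by fun_prop
  have h1 (x : EuclideanSpace ℝ (Fin m)) :
      ∫ y in ball (0 : EuclideanSpace ℝ (Fin m)) 1, ‖x - y‖ ^ β =
      (∫⁻ y in ball (0 : EuclideanSpace ℝ (Fin m)) 1, ENNReal.ofReal (‖x - y‖ ^ β)).toReal :=
    integral_eq_lintegral_of_nonneg_ae (Filter.Eventually.of_forall fun y ↦ by
      simp only [Pi.zero_apply]; positivity)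
      (show Measurable fun y ↦ ‖x - y‖ ^ β by fun_prop).aestronglyMeasurable
  simp_rw [h1]
  rw [integral_toReal hmeas.lintegral_prod_right'.aemeasurable]
  · refine ENNReal.ofReal_toReal (ne_top_of_le_ne_top ?_
      (setLIntegral_mono' measurableSet_ball hle))
    simpa using ENNReal.mul_ne_top hM measure_ball_lt_top.ne
  · exact (ae_restrict_iff' measurableSet_ball).2 (Filter.Eventually.of_forall fun x hx ↦
      (hle x hx).trans_lt hM.lt_top)

lemma lintegral_Ioi_heatContent_ball {m : ℕ} (hm : 2 ≤ m) {a α t : ℝ} (ha : 0 < a)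
    (hα₁ : 1 / (2 * m) < α) (hα₂ : α < 1 / m) (ht : 0 < t) :
    ∫⁻ s in Set.Ioi (0 : ℝ),
      heatContent (ball (0 : EuclideanSpace ℝ (Fin m)) (a * s ^ (-α))) t =
    ENNReal.ofReal ((2 ^ ((m : ℝ) - 1 - 1 / α) * Real.pi ^ (-(m : ℝ) / 2) * α⁻¹ *
      Real.Gamma ((2 * (m : ℝ) * α - 1) / (2 * α)) * a ^ (1 / α) *
      ∫ x in ball (0 : EuclideanSpace ℝ (Fin m)) 1,
        ∫ y in ball (0 : EuclideanSpace ℝ (Fin m)) 1,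
          ‖x - y‖ ^ ((1 - 2 * (m : ℝ) * α) / α)) * t ^ (((m : ℝ) * α - 1) / (2 * α))) := by
  have : Nonempty (Fin m) := ⟨⟨0, by omega⟩⟩
  have hm0 : (0 : ℝ) < m := by exact_mod_cast (show 0 < m by omega)
  have hα : 0 < α := lt_trans (by positivity) hα₁
  have hmα : (m : ℝ) * α < 1 := by rwa [lt_div_iff₀ hm0, mul_comm] at hα₂
  have hmα' : 1 < 2 * (m : ℝ) * α := by
    rwa [div_lt_iff₀ (by positivity), mul_comm] at hα₁
  have hσ : 0 < (m : ℝ) - 1 / (2 * α) := by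
    rw [sub_pos, div_lt_iff₀ (by positivity)]
    linarith
  have hΓ : 0 < Real.Gamma ((2 * (m : ℝ) * α - 1) / (2 * α)) :=
    Real.Gamma_pos_of_pos (div_pos (by linarith) (by positivity))
  have hβ : -(m : ℝ) < (1 - 2 * (m : ℝ) * α) / α := by
    rw [lt_div_iff₀ hα]
    linarith
  let g : ℝ → EuclideanSpace ℝ (Fin m) → EuclideanSpace ℝ (Fin m) → ℝ≥0∞ := fun s x y ↦
    ENNReal.ofReal ((a * s ^ (-α)) ^ (2 * m) * gaussKernel m t (a * s ^ (-α) * dist x y))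
  have hgm := (continuous_gaussKernel m t).measurable
  have hg1 : Measurable fun p : (ℝ × EuclideanSpace ℝ (Fin m)) × EuclideanSpace ℝ (Fin m) ↦
      g p.1.1 p.1.2 p.2 := by
    simp only [g]
    fun_prop
  have hg2 (x : EuclideanSpace ℝ (Fin m)) : Measurable fun p : ℝ × EuclideanSpace ℝ (Fin m) ↦
      g p.1 x p.2 := by
    simp only [g]
    fun_prop
  set C : ℝ := 2 ^ ((m : ℝ) - 1 - 1 / α) * Real.pi ^ (-(m : ℝ) / 2) * α⁻¹ *
      Real.Gamma ((2 * (m : ℝ) * α - 1) / (2 * α)) * a ^ (1 / α) with hC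
  have hC0 : 0 ≤ C := by positivity
  calc _ = ∫⁻ s in Set.Ioi (0 : ℝ), ∫⁻ x in ball (0 : EuclideanSpace ℝ (Fin m)) 1,
        ∫⁻ y in ball (0 : EuclideanSpace ℝ (Fin m)) 1, g s x y :=
        setLIntegral_congr_fun measurableSet_Ioi fun s hs ↦
          heatContent_ball 0 (mul_pos ha (Real.rpow_pos_of_pos hs _)) t
    _ = ∫⁻ x in ball (0 : EuclideanSpace ℝ (Fin m)) 1, ∫⁻ s in Set.Ioi (0 : ℝ),
        ∫⁻ y in ball (0 : EuclideanSpace ℝ (Fin m)) 1, g s x y :=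
        lintegral_lintegral_swap hg1.lintegral_prod_right'.aemeasurable
    _ = ∫⁻ x in ball (0 : EuclideanSpace ℝ (Fin m)) 1,
        ∫⁻ y in ball (0 : EuclideanSpace ℝ (Fin m)) 1, ∫⁻ s in Set.Ioi (0 : ℝ), g s x y :=
        lintegral_congr fun x ↦ lintegral_lintegral_swap (hg2 x).aemeasurable
    _ = ∫⁻ x in ball (0 : EuclideanSpace ℝ (Fin m)) 1,
        ∫⁻ y in ball (0 : EuclideanSpace ℝ (Fin m)) 1,
          ENNReal.ofReal (C * t ^ (((m : ℝ) * α - 1) / (2 * α))) *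
            ENNReal.ofReal (‖x - y‖ ^ ((1 - 2 * (m : ℝ) * α) / α)) := by
        refine lintegral_congr fun x ↦ lintegral_congr_ae (ae_restrict_of_ae ?_)
        have hx : ∀ᵐ y : EuclideanSpace ℝ (Fin m), y ≠ x := by
          simp [ae_iff]
        filter_upwards [hx] with y hy
        rw [← dist_eq_norm]
        exact lintegral_Ioi_gaussKernel_rpow m ha hα hσ ht (dist_pos.2 hy.symm)
    _ = _ := by
        simp_rw [lintegral_const_mul' _ _ ENNReal.ofReal_ne_top]
        rw [← ofReal_integral_ball_rpow hm hβ, ← ENNReal.ofReal_mul (by positivity)]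
        congr 1
        ring

lemma gaussKernel_anti {m : ℕ} {t : ℝ} (ht : 0 < t) {d d' : ℝ} (hd : 0 ≤ d) (h : d ≤ d') :
    gaussKernel m t d' ≤ gaussKernel m t d := by
  unfold gaussKernel
  gcongr

lemma gaussKernel_half_le (m : ℕ) {t d : ℝ} (ht : 0 < t) (ht1 : t < 1) (hd : 0 < d) :
    gaussKernel m t (d / 2) ≤ m.factorial * 16 ^ m * d ^ (-(2 * m : ℝ)) := by
  set u : ℝ := d ^ 2 / (16 * t) with hu
  have hu0 : 0 < u := by positivity
  have h1 : Real.exp (-(d / 2) ^ 2 / (4 * t)) ≤ m.factorial * 16 ^ m * t ^ m * d ^ (-(2 * m : ℝ)) := by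
    have h2 := Real.pow_div_factorial_le_exp u hu0.le m
    rw [show -(d / 2) ^ 2 / (4 * t) = -u by rw [hu]; ring, Real.exp_neg]
    calc (Real.exp u)⁻¹ ≤ (u ^ m / m.factorial)⁻¹ := by gcongr
      _ = _ := by
        rw [Real.rpow_neg hd.le, show (2 * m : ℝ) = ((2 * m : ℕ) : ℝ) by push_cast; ring,
          Real.rpow_natCast, hu, div_pow, mul_pow, ← pow_mul]
        field_simp
  have h3 : (4 * Real.pi * t) ^ (-(m : ℝ) / 2) ≤ t ^ (-(m : ℝ) / 2) :=
    Real.rpow_le_rpow_of_nonpos ht (by nlinarith [Real.pi_gt_three])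
      (by have : (0 : ℝ) ≤ m := m.cast_nonneg
          linarith)
  have h4 : t ^ (-(m : ℝ) / 2) * t ^ m ≤ 1 := by
    rw [← Real.rpow_natCast, ← Real.rpow_add ht]
    exact Real.rpow_le_one ht.le ht1.le (by
      have : (0 : ℝ) ≤ m := m.cast_nonneg
      linarith)
  calc gaussKernel m t (d / 2)
      ≤ t ^ (-(m : ℝ) / 2) * (m.factorial * 16 ^ m * t ^ m * d ^ (-(2 * m : ℝ))) := by
        unfold gaussKernel
        gcongr
    _ = (t ^ (-(m : ℝ) / 2) * t ^ m) * (m.factorial * 16 ^ m * d ^ (-(2 * m : ℝ))) := by ring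
    _ ≤ _ := mul_le_of_le_one_left (by positivity) h4

lemma IsLatticeEnum.exists_int_sub {m : ℕ} {z : ℕ → EuclideanSpace ℝ (Fin m)}
    (hz : IsLatticeEnum m z) (i j : ℕ) (l : Fin m) : ∃ k : ℤ, (z i - z j) l = k := by
  have h (i : ℕ) : ∃ k : ℤ, z i l = k := by
    have : z i ∈ Set.range z := ⟨i, rfl⟩
    rw [hz.2] at this
    exact this l
  obtain ⟨k, hk⟩ := h i
  obtain ⟨k', hk'⟩ := h j
  exact ⟨k - k', by simp [hk, hk']⟩

lemma IsLatticeEnum.one_le_dist_s11 {m : ℕ} {z : ℕ → EuclideanSpace ℝ (Fin m)}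
    (hz : IsLatticeEnum m z) {i j : ℕ} (hij : i ≠ j) : 1 ≤ dist (z i) (z j) := by
  rw [dist_eq_norm]
  have hne : z i - z j ≠ 0 := sub_ne_zero.2 (hz.1.ne hij)
  obtain ⟨l, hl⟩ : ∃ l, (z i - z j) l ≠ 0 := by
    by_contra! h
    exact hne (by ext l; exact h l)
  obtain ⟨k, hk⟩ := hz.exists_int_sub i j l
  have h1 := PiLp.norm_apply_le (z i - z j) l
  rw [hk] at h1 hl
  refine le_trans ?_ h1
  rw [Real.norm_eq_abs, ← Int.cast_abs]
  exact_mod_cast Int.one_le_abs (by rintro rfl; simp at hl)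

/-- Lattice sums of `‖z i - z j‖ ^ (-2m)` are bounded uniformly in the base point. -/
lemma IsLatticeEnum.exists_tsum_norm_sub_rpow_le {m : ℕ} (hm : 2 ≤ m)
    {z : ℕ → EuclideanSpace ℝ (Fin m)} (hz : IsLatticeEnum m z) :
    ∃ S : ℝ≥0∞, S ≠ ⊤ ∧ ∀ i, ∑' j, ENNReal.ofReal (‖z i - z j‖ ^ (-(2 * m : ℝ))) ≤ S := by
  let b := (EuclideanSpace.basisFun (Fin m) ℝ).toBasis
  let L := Submodule.span ℤ (Set.range b)
  have hL (i j : ℕ) : z i - z j ∈ L := by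
    rw [Module.Basis.mem_span_iff_repr_mem]
    intro l
    obtain ⟨k, hk⟩ := hz.exists_int_sub i j l
    exact ⟨k, by simpa [b] using hk.symm⟩
  have hrank : Module.finrank ℤ L = m := by
    rw [ZLattice.rank ℝ L, finrank_euclideanSpace_fin]
  have hsum : Summable fun w : L ↦ ‖w‖ ^ (-(2 * m : ℝ)) := by
    refine ZLattice.summable_norm_rpow L _ ?_
    have : (0 : ℝ) < m := by exact_mod_cast (show 0 < m by omega)
    rw [hrank]
    linarith
  refine ⟨_, hsum.tsum_ofReal_ne_top, fun i ↦ ?_⟩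
  have hinj : Function.Injective fun j ↦ (⟨z i - z j, hL i j⟩ : L) := fun j j' h ↦
    hz.1 (sub_right_injective (congrArg Subtype.val h))
  exact ENNReal.tsum_comp_le_tsum_of_injective hinj
    fun w : L ↦ ENNReal.ofReal (‖w‖ ^ (-(2 * m : ℝ)))

lemma tsum_tsum_mul_add_le {v : ℕ → ℝ≥0∞} {G : ℕ → ℕ → ℝ≥0∞} {S : ℝ≥0∞}
    (hG : ∀ i j, G i j = G j i) (hS : ∀ i, ∑' j, G i j ≤ S) :
    ∑' i, ∑' j, (v i + v j) * G i j ≤ 2 * ((∑' i, v i) * S) := by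
  simp_rw [add_mul, ENNReal.tsum_add]
  have h1 : ∑' i, ∑' j, v i * G i j ≤ (∑' i, v i) * S := by
    simp_rw [ENNReal.tsum_mul_left]
    rw [← ENNReal.tsum_mul_right]
    gcongr with i
    exact hS i
  have h2 : ∑' i, ∑' j, v j * G i j = ∑' i, ∑' j, v i * G i j := by
    rw [ENNReal.tsum_comm]
    simp_rw [hG]
  rw [h2, two_mul]
  gcongr

lemma ENNReal.mul_le_sq_add_sq (x y : ℝ≥0∞) : x * y ≤ x ^ 2 + y ^ 2 := by
  rcases le_total x y with h | h
  · exact le_add_left (by rw [sq]; gcongr)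
  · exact le_add_right (by rw [sq]; gcongr)

/-- Decomposition of the heat content of a union of disjoint balls. -/
lemma heatContent_iUnion_ball {m : ℕ} {z : ℕ → EuclideanSpace ℝ (Fin m)} {r : ℕ → ℝ}
    (hd : Pairwise (Function.onFun Disjoint fun i ↦ ball (z i) (r i))) (t : ℝ) :
    heatContent (⋃ i, ball (z i) (r i)) t =
      ∑' i, heatContent (ball (z i) (r i)) t +
      ∑' i, ∑' j, if i = j then 0 else ∫⁻ x in ball (z i) (r i), ∫⁻ y in ball (z j) (r j),
        ENNReal.ofReal (gaussKernel m t (dist x y)) := by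
  have h1 : heatContent (⋃ i, ball (z i) (r i)) t =
      ∑' i, ∑' j, ∫⁻ x in ball (z i) (r i), ∫⁻ y in ball (z j) (r j),
        ENNReal.ofReal (gaussKernel m t (dist x y)) := by
    rw [heatContent_eq, lintegral_iUnion (fun _ ↦ measurableSet_ball) hd]
    refine tsum_congr fun i ↦ ?_
    simp_rw [lintegral_iUnion (fun _ ↦ measurableSet_ball) hd]
    exact lintegral_tsum fun j ↦
      (measurable_gaussKernel_dist t).lintegral_prod_right'.aemeasurable
  rw [h1, ← ENNReal.tsum_add]
  refine tsum_congr fun i ↦ ?_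
  rw [heatContent_eq, ← tsum_ite_eq i (fun j ↦ ∫⁻ x in ball (z i) (r i),
    ∫⁻ y in ball (z j) (r j), ENNReal.ofReal (gaussKernel m t (dist x y))), ← ENNReal.tsum_add]
  refine tsum_congr fun j ↦ ?_
  by_cases h : i = j
  · simp [h]
  · simp [h, Ne.symm h]

/-- Heat exchange between two well-separated balls. -/
lemma lintegral_ball_ball_gaussKernel_le {m : ℕ} {x₀ y₀ : EuclideanSpace ℝ (Fin m)} {ρ ρ' t : ℝ}
    (hρ : ρ ≤ 1 / 4) (hρ' : ρ' ≤ 1 / 4) (hd : 1 ≤ dist x₀ y₀) (ht : 0 < t) (ht1 : t < 1) :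
    ∫⁻ x in ball x₀ ρ, ∫⁻ y in ball y₀ ρ', ENNReal.ofReal (gaussKernel m t (dist x y)) ≤
      volume (ball x₀ ρ) * volume (ball y₀ ρ') *
        ENNReal.ofReal (m.factorial * 16 ^ m * ‖x₀ - y₀‖ ^ (-(2 * m : ℝ))) := by
  rw [← dist_eq_norm]
  set A := ENNReal.ofReal (m.factorial * 16 ^ m * dist x₀ y₀ ^ (-(2 * m : ℝ)))
  calc _ ≤ ∫⁻ _ in ball x₀ ρ, ∫⁻ _ in ball y₀ ρ', A := by
        refine setLIntegral_mono' measurableSet_ball fun x hx ↦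
          setLIntegral_mono' measurableSet_ball fun y hy ↦ ENNReal.ofReal_le_ofReal ?_
        refine (gaussKernel_anti ht (d := dist x₀ y₀ / 2) (by positivity) ?_).trans
          (gaussKernel_half_le m ht ht1 (by linarith))
        rw [mem_ball] at hx hy
        have := dist_triangle4 x₀ x y y₀
        rw [dist_comm x₀ x] at this
        linarith
    _ = _ := by
        simp only [setLIntegral_const]
        ring

/-- Theorem 4, first regime `1/(2m) < α < 1/m`: for `Ω` the union of the balls
`B(z_i; a i^{-α})` centred at the points of `ℤᵐ`,
`H_Ω(t) = c_{α,m} t^{(mα-1)/(2α)} + O(1)` as `t ↓ 0`, where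
`c_{α,m} = 2^{m-1-1/α} π^{-m/2} α⁻¹ Γ((2mα-1)/(2α)) a^{1/α}
  ∫_{B(0;1)} ∫_{B(0;1)} |x-y|^{(1-2mα)/α} dy dx`. -/
theorem heat_content_asymptotics_infinite_volume_regime
    (m : ℕ) (hm : 2 ≤ m) (a α : ℝ) (ha : 0 < a) (ha' : a ≤ 1 / 4)
    (hα₁ : 1 / (2 * m) < α) (hα₂ : α < 1 / m)
    (z : ℕ → EuclideanSpace ℝ (Fin m)) (hz : IsLatticeEnum m z)
    (r : ℕ → ℝ) (hr : ∀ i : ℕ, r i = a * ((i : ℝ) + 1) ^ (-α))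
    (Ω : Set (EuclideanSpace ℝ (Fin m))) (hΩ : Ω = ⋃ i : ℕ, ball (z i) (r i))
    (c : ℝ)
    (hc : c = 2 ^ ((m : ℝ) - 1 - 1 / α) * Real.pi ^ (-(m : ℝ) / 2) * α⁻¹ *
      Real.Gamma ((2 * (m : ℝ) * α - 1) / (2 * α)) * a ^ (1 / α) *
      ∫ x in ball (0 : EuclideanSpace ℝ (Fin m)) 1,
        ∫ y in ball (0 : EuclideanSpace ℝ (Fin m)) 1,
          ‖x - y‖ ^ ((1 - 2 * (m : ℝ) * α) / α)) :
    ∃ t₀ > (0 : ℝ), ∃ K > (0 : ℝ), ∀ t : ℝ, 0 < t → t < t₀ →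
      heatContent Ω t ≠ ⊤ ∧
      |(heatContent Ω t).toReal - c * t ^ (((m : ℝ) * α - 1) / (2 * α))| ≤ K := by
  have : Nonempty (Fin m) := ⟨⟨0, by omega⟩⟩
  have hm0 : (0 : ℝ) < m := by exact_mod_cast (show 0 < m by omega)
  have hα : 0 < α := lt_trans (by positivity) hα₁
  have hmα : (m : ℝ) * α < 1 := by rwa [lt_div_iff₀ hm0, mul_comm] at hα₂
  have hmα' : 1 < 2 * (m : ℝ) * α := by
    rwa [div_lt_iff₀ (by positivity), mul_comm] at hα₁
  have hΓ : 0 < Real.Gamma ((2 * (m : ℝ) * α - 1) / (2 * α)) :=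
    Real.Gamma_pos_of_pos (div_pos (by linarith) (by positivity))
  have hc0 : 0 ≤ c := by
    rw [hc]
    have : 0 ≤ ∫ x in ball (0 : EuclideanSpace ℝ (Fin m)) 1,
        ∫ y in ball (0 : EuclideanSpace ℝ (Fin m)) 1,
          ‖x - y‖ ^ ((1 - 2 * (m : ℝ) * α) / α) :=
      integral_nonneg fun x ↦ integral_nonneg fun y ↦ by positivity
    positivity
  have hr0 (i : ℕ) : 0 < r i := by rw [hr]; positivity
  have hr1 (i : ℕ) : r i ≤ 1 / 4 := by
    rw [hr]
    refine (mul_le_of_le_one_right ha.le ?_).trans ha'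
    exact Real.rpow_le_one_of_one_le_of_nonpos (by simp) (by linarith)
  have hdisj : Pairwise (Function.onFun Disjoint fun i ↦ ball (z i) (r i)) := fun i j hij ↦
    ball_disjoint_ball (by linarith [hr1 i, hr1 j, hz.one_le_dist_s11 hij])
  set V := volume (ball (0 : EuclideanSpace ℝ (Fin m)) 1) with hV
  have hVtop : V ≠ ⊤ := measure_ball_lt_top.ne
  have hvol (x : EuclideanSpace ℝ (Fin m)) {ρ : ℝ} (hρ : 0 ≤ ρ) :
      volume (ball x ρ) = ENNReal.ofReal (ρ ^ m) * V := by
    rw [Measure.addHaar_ball _ _ hρ, finrank_euclideanSpace_fin]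
  obtain ⟨S, hS, hSle⟩ := hz.exists_tsum_norm_sub_rpow_le hm
  set T : ℝ≥0∞ := ∑' i, volume (ball (z i) (r i)) ^ 2 with hT
  have hTtop : T ≠ ⊤ := by
    have h1 (i : ℕ) : volume (ball (z i) (r i)) ^ 2 =
        ENNReal.ofReal (a ^ (2 * m) * ((i + 1 : ℕ) : ℝ) ^ (-(2 * m * α))) * V ^ 2 := by
      rw [hvol _ (hr0 i).le, mul_pow, ← ENNReal.ofReal_pow (by have := hr0 i; positivity),
        hr, mul_pow, mul_pow, ← pow_mul, ← pow_mul, ← Real.rpow_natCast (_ ^ (-α)),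
        ← Real.rpow_mul (by positivity)]
      push_cast
      ring_nf
    simp_rw [hT, h1, ENNReal.tsum_mul_right]
    refine ENNReal.mul_ne_top (Summable.tsum_ofReal_ne_top ?_) (ENNReal.pow_ne_top hVtop)
    exact ((summable_nat_add_iff 1).2 (Real.summable_nat_rpow.2 (by linarith))).mul_left _
  set A : ℝ≥0∞ := ENNReal.ofReal (m.factorial * 16 ^ m) with hA
  set C₁ : ℝ≥0∞ := 2 * (T * (A * S)) with hC₁
  have hC₁top : C₁ ≠ ⊤ := by
    have : A ≠ ⊤ := ENNReal.ofReal_ne_top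
    finiteness
  have hoff {t : ℝ} (ht : 0 < t) (ht1 : t < 1) :
      (∑' i, ∑' j, if i = j then 0 else ∫⁻ x in ball (z i) (r i), ∫⁻ y in ball (z j) (r j),
        ENNReal.ofReal (gaussKernel m t (dist x y))) ≤ C₁ := by
    refine le_trans (ENNReal.tsum_le_tsum fun i ↦ ENNReal.tsum_le_tsum fun j ↦ ?_)
      (tsum_tsum_mul_add_le (v := fun i ↦ volume (ball (z i) (r i)) ^ 2)
        (G := fun i j ↦ A * ENNReal.ofReal (‖z i - z j‖ ^ (-(2 * m : ℝ))))
        (fun i j ↦ by rw [norm_sub_rev]) (fun i ↦ ?_))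
    · split_ifs with h
      · exact zero_le
      · refine (lintegral_ball_ball_gaussKernel_le (hr1 i) (hr1 j) (hz.one_le_dist_s11 h)
          ht ht1).trans ?_
        rw [ENNReal.ofReal_mul (by positivity)]
        gcongr
        exact ENNReal.mul_le_sq_add_sq _ _
    · rw [ENNReal.tsum_mul_left]
      gcongr
      exact hSle i
  set C₂ : ℝ≥0∞ := ∫⁻ s in Set.Ioc (0 : ℝ) 1, ENNReal.ofReal (a ^ m * s ^ (-(m * α))) * V with hC₂
  have hC₂top : C₂ ≠ ⊤ := by
    rw [hC₂, lintegral_mul_const' _ _ hVtop]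
    refine ENNReal.mul_ne_top ?_ hVtop
    have h1 : IntegrableOn (fun s : ℝ ↦ s ^ (-(m * α))) (Set.Ioc 0 1) :=
      (intervalIntegrable_iff_integrableOn_Ioc_of_le zero_le_one).1
        (intervalIntegral.intervalIntegrable_rpow' (by linarith))
    exact (h1.const_mul (a ^ m)).lintegral_lt_top.ne
  refine ⟨1, one_pos, C₁.toReal + C₂.toReal + 1, by positivity, fun t ht ht1 ↦ ?_⟩
  set f : ℝ → ℝ≥0∞ := fun s ↦
    heatContent (ball (0 : EuclideanSpace ℝ (Fin m)) (a * s ^ (-α))) t with hf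
  have hanti : AntitoneOn f (Set.Ioi 0) := fun s hs s' _ hss ↦
    heatContent_mono (ball_subset_ball (mul_le_mul_of_nonneg_left
      (Real.rpow_le_rpow_of_nonpos hs hss (by linarith)) ha.le)) t
  set F : ℝ := c * t ^ (((m : ℝ) * α - 1) / (2 * α)) with hF
  have hF0 : 0 ≤ F := by positivity
  have hint : ∫⁻ s in Set.Ioi (0 : ℝ), f s = ENNReal.ofReal F := by
    rw [hF, hc]
    exact lintegral_Ioi_heatContent_ball hm ha hα₁ hα₂ ht
  set D : ℝ≥0∞ := ∑' i : ℕ, f (i + 1) with hD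
  have hDF : D ≤ ENNReal.ofReal F := hint ▸ tsum_le_lintegral_of_antitoneOn hanti
  have hFD : ENNReal.ofReal F ≤ C₂ + D := by
    rw [← hint]
    refine (lintegral_le_tsum_of_antitoneOn hanti).trans ?_
    gcongr
    refine setLIntegral_mono' measurableSet_Ioc fun s hs ↦ ?_
    have hs0 : 0 < s := hs.1
    refine (heatContent_le_volume _ ht).trans_eq ?_
    rw [hvol _ (by positivity), mul_pow, ← Real.rpow_natCast (s ^ (-α)), ← Real.rpow_mul hs0.le]
    ring_nf
  have hH := heatContent_iUnion_ball hdisj t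
  rw [← hΩ] at hH
  have hdiag : ∑' i, heatContent (ball (z i) (r i)) t = D :=
    tsum_congr fun i ↦ by rw [heatContent_ball_eq_zero_center _ (hr0 i), hr]
  rw [hdiag] at hH
  have hO := hoff ht ht1
  set O := (∑' i, ∑' j, if i = j then 0 else ∫⁻ x in ball (z i) (r i), ∫⁻ y in ball (z j) (r j),
        ENNReal.ofReal (gaussKernel m t (dist x y)))
  have hDtop : D ≠ ⊤ := ne_top_of_le_ne_top ENNReal.ofReal_ne_top hDF
  have hOtop : O ≠ ⊤ := ne_top_of_le_ne_top hC₁top hO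
  rw [hH]
  refine ⟨ENNReal.add_ne_top.2 ⟨hDtop, hOtop⟩, ?_⟩
  rw [ENNReal.toReal_add hDtop hOtop]
  have h1 : D.toReal ≤ F := ENNReal.toReal_le_of_le_ofReal hF0 hDF
  have h2 : F ≤ C₂.toReal + D.toReal := by
    rw [← ENNReal.toReal_add hC₂top hDtop]
    exact (ENNReal.ofReal_le_iff_le_toReal (ENNReal.add_ne_top.2 ⟨hC₂top, hDtop⟩)).1 hFD
  have h3 : O.toReal ≤ C₁.toReal := ENNReal.toReal_mono hC₁top hO
  have h4 : 0 ≤ O.toReal := ENNReal.toReal_nonneg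
  have h5 : 0 ≤ C₁.toReal := ENNReal.toReal_nonneg
  have h6 : 0 ≤ C₂.toReal := ENNReal.toReal_nonneg
  rw [abs_le]
  constructor <;> linarith
end
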